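/- arXiv:2105.13088 — 7 statements merged into one kernel-verified Lean document; each statement's English description precedes it below -/
import Mathlib

section
/- Let (X,d) be a compact metric space and μ a Borel probability measure on X with full support. Let n ≥ 2 be an integer and set v_n(s) := (∫_0^s (sin t)^{n−1} dt)/(∫_0^π (sin t)^{n−1} dt) for s ∈ [0,π]. Assume diam(X,d) ≤ π and μ(B_s(x)) ≥ v_n(s) for every x ∈ X and every s ∈ [0,π], where B_s(x) is the closed ball of radius s around x. Then for every x ∈ X, ∫_X d(x,y) dμ(y) ≤ π/2. -/
open MeasureTheory Metric Real

/-- The complements of the balls of radius `s` in a round sphere have average normalized volume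
`1 / 2` as `s` ranges over `[0, π]`, by the symmetry `sin (π - t) = sin t`. -/
theorem integral_one_sub_sin_pow_ratio (m : ℕ) :
    ∫ s in (0 : ℝ)..π, (1 - (∫ t in (0 : ℝ)..s, Real.sin t ^ m)
      / (∫ t in (0 : ℝ)..π, Real.sin t ^ m)) = π / 2 := by
  have hint : ∀ a b : ℝ, IntervalIntegrable (fun t => Real.sin t ^ m) volume a b :=
    fun a b => (by fun_prop : Continuous fun t => Real.sin t ^ m).intervalIntegrable a b
  set v : ℝ → ℝ := fun s => (∫ t in (0 : ℝ)..s, Real.sin t ^ m)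
    / (∫ t in (0 : ℝ)..π, Real.sin t ^ m) with hv
  have hsymm : ∀ s, v (π - s) = 1 - v s := by
    intro s
    have hne : (∫ t in (0 : ℝ)..π, Real.sin t ^ m) ≠ 0 := (integral_sin_pow_pos m).ne'
    have hrefl : ∫ t in (0 : ℝ)..(π - s), Real.sin t ^ m = ∫ t in s..π, Real.sin t ^ m := by
      have h := intervalIntegral.integral_comp_sub_left (a := s) (b := π)
        (fun t => Real.sin t ^ m) π
      simpa [Real.sin_pi_sub] using h.symm
    have hadd := intervalIntegral.integral_add_adjacent_intervals (hint 0 s) (hint s π)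
    simp only [hv]
    rw [hrefl, eq_sub_iff_add_eq, ← add_div, add_comm, hadd, div_self hne]
  have hcont : Continuous v :=
    (intervalIntegral.continuous_primitive (fun a b => hint a b) 0).div_const _
  have h₁ : ∫ s in (0 : ℝ)..π, (1 - v s) = ∫ s in (0 : ℝ)..π, v s := by
    simp_rw [← hsymm]
    simp
  have h₂ := intervalIntegral.integral_sub (μ := volume) (a := 0) (b := π)
    (f := fun _ => (1 : ℝ)) (g := v) (by simp) (hcont.intervalIntegrable _ _)
  simp only [intervalIntegral.integral_const, sub_zero, smul_eq_mul, mul_one] at h₂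
  linarith

/-- Pointwise mean-distance bound: if `(X,d)` is a compact metric space with a Borel
probability measure `μ` of full support, `n ≥ 2`, `diam X ≤ π`, and the Bishop–Gromov
type inequality `μ (closedBall x s) ≥ v n s` holds for all `x` and `s ∈ [0,π]`, where
`v n s = (∫₀^s sin t ^ (n-1) dt)/(∫₀^π sin t ^ (n-1) dt)`, then
`∫ y, dist x y dμ(y) ≤ π/2` for every `x`. -/
theorem pointwise_mean_distance_le {X : Type*} [MetricSpace X] [CompactSpace X]
    [MeasurableSpace X] [BorelSpace X]
    (μ : Measure X) [IsProbabilityMeasure μ] [μ.IsOpenPosMeasure]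
    (n : ℕ) (hn : 2 ≤ n)
    (hdiam : Metric.diam (Set.univ : Set X) ≤ π)
    (hball : ∀ (x : X), ∀ s ∈ Set.Icc (0 : ℝ) π,
      (∫ t in (0 : ℝ)..s, Real.sin t ^ (n - 1))
          / (∫ t in (0 : ℝ)..π, Real.sin t ^ (n - 1))
        ≤ (μ (Metric.closedBall x s)).toReal)
    (x : X) :
    ∫ y, dist x y ∂μ ≤ π / 2 := by
  have hle : ∀ y, dist x y ≤ π := fun y =>
    (dist_le_diam_of_mem isCompact_univ.isBounded (Set.mem_univ x) (Set.mem_univ y)).trans hdiam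
  have hcont : Continuous fun y => dist x y := by fun_prop
  have hdist : Integrable (fun y => dist x y) μ :=
    Integrable.of_bound hcont.aestronglyMeasurable π
      (.of_forall fun y => by simpa [abs_of_nonneg dist_nonneg] using hle y)
  have hratio : Continuous fun s => 1 - (∫ t in (0 : ℝ)..s, Real.sin t ^ (n - 1))
      / (∫ t in (0 : ℝ)..π, Real.sin t ^ (n - 1)) :=
    continuous_const.sub ((intervalIntegral.continuous_primitive (fun a b =>
      (by fun_prop : Continuous fun t => Real.sin t ^ (n - 1)).intervalIntegrable a b) 0).div_const _)
  have hanti : Antitone fun s : ℝ => μ.real {y | s < dist x y} := fun a b hab =>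
    measureReal_mono fun y (hy : b < dist x y) => hab.trans_lt hy
  have hzero : ∀ s ∈ Set.Ioi (0 : ℝ) \ Set.Ioc 0 π, μ.real {y | s < dist x y} = 0 := by
    rintro s ⟨hs, hs'⟩
    have hs'' : π < s := by
      by_contra! h
      exact hs' ⟨hs, h⟩
    have : {y | s < dist x y} = ∅ :=
      Set.eq_empty_of_forall_notMem fun y (hy : s < dist x y) => by linarith [hle y]
    simp [this]
  rw [hdist.integral_eq_integral_meas_lt (.of_forall fun y => dist_nonneg),
    setIntegral_eq_of_subset_of_forall_sdiff_eq_zero measurableSet_Ioi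
      Set.Ioc_subset_Ioi_self hzero,
    ← intervalIntegral.integral_of_le Real.pi_pos.le, ← integral_one_sub_sin_pow_ratio (n - 1)]
  refine intervalIntegral.integral_mono_on Real.pi_pos.le hanti.intervalIntegrable
    (hratio.intervalIntegrable _ _) fun s hs => ?_
  have hcompl : {y | s < dist x y} = (closedBall x s)ᶜ := by
    ext y
    simp [dist_comm]
  rw [hcompl, probReal_compl_eq_one_sub isClosed_closedBall.measurableSet]
  exact sub_le_sub_left (hball x s hs) 1
end

section
/- Let (X,d) be a compact metric space and μ a Borel probability measure on X with full support. Let n ≥ 2 be an integer and set v_n(s) := (∫_0^s (sin t)^{n−1} dt)/(∫_0^π (sin t)^{n−1} dt) for s ∈ [0,π]. Assume diam(X,d) ≤ π and μ(B_s(x)) ≥ v_n(s) for every x ∈ X and every s ∈ [0,π], where B_s(x) is the closed ball of radius s around x. If md(X) := ∫_{X×X} d(x,y) dμ(x)dμ(y) = π/2, then for every x ∈ X there exists x' ∈ X with d(x,x') = π; in particular rad(X,d) := inf_{x∈X} sup_{y∈X} d(x,y) = π. -/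
open MeasureTheory Metric Real

/-- The layer-cake formula turns lower bounds on the measures of closed balls into an upper bound
on the mean distance to a point. -/
theorem integral_dist_le_of_le_measureReal_closedBall {X : Type*} [MetricSpace X] [CompactSpace X]
    [MeasurableSpace X] [BorelSpace X] (μ : Measure X) [IsProbabilityMeasure μ]
    {v : ℝ → ℝ} {r : ℝ} {x : X} (hv : Continuous v) (hr : 0 ≤ r) (hx : ∀ y, dist x y ≤ r)
    (hball : ∀ s ∈ Set.Icc (0 : ℝ) r, v s ≤ μ.real (closedBall x s)) :
    ∫ y, dist x y ∂μ ≤ ∫ s in (0 : ℝ)..r, (1 - v s) := by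
  have hc : Continuous fun y => dist x y := by fun_prop
  have hd_int : Integrable (fun y => dist x y) μ :=
    hc.integrable_of_hasCompactSupport (HasCompactSupport.of_compactSpace _)
  have hset : ∀ s : ℝ, {y | s < dist x y} = (closedBall x s)ᶜ := by
    intro s
    ext y
    simp [dist_comm]
  rw [hd_int.integral_eq_integral_meas_lt (Filter.Eventually.of_forall fun y => dist_nonneg),
    intervalIntegral.integral_of_le hr,
    setIntegral_eq_of_subset_of_forall_sdiff_eq_zero measurableSet_Ioi Set.Ioc_subset_Ioi_self]
  · refine setIntegral_mono_on ?_ ?_ measurableSet_Ioc ?_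
    · have hanti : Antitone fun s : ℝ => μ.real {y | s < dist x y} := fun s t hst =>
        measureReal_mono fun y (hy : t < dist x y) => lt_of_le_of_lt hst hy
      exact (hanti.intervalIntegrable (a := 0) (b := r)).1
    · exact (by fun_prop : Continuous fun s => 1 - v s).integrableOn_Ioc
    · intro s hs
      rw [hset, probReal_compl_eq_one_sub isClosed_closedBall.measurableSet]
      linarith [hball s ⟨hs.1.le, hs.2⟩]
  · rintro s ⟨hs0, hs⟩
    have hrs : r < s := by
      by_contra! h
      exact hs ⟨hs0, h⟩
    have : {y | s < dist x y} = ∅ := by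
      ext y
      simpa using (hx y).trans hrs.le
    simp [this]

theorem integral_sin_pow_add_integral_sin_pow_pi_sub (m : ℕ) (s : ℝ) :
    (∫ t in (0 : ℝ)..s, sin t ^ m) + ∫ t in (0 : ℝ)..(π - s), sin t ^ m
      = ∫ t in (0 : ℝ)..π, sin t ^ m := by
  have hi : ∀ a b : ℝ, IntervalIntegrable (fun t => sin t ^ m) volume a b := fun a b =>
    (by fun_prop : Continuous fun t => sin t ^ m).intervalIntegrable a b
  have h := intervalIntegral.integral_comp_sub_left (a := s) (b := π) (fun t => sin t ^ m) π
  simp only [sin_pi_sub, sub_self] at h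
  rw [← h, intervalIntegral.integral_add_adjacent_intervals (hi _ _) (hi _ _)]

/-- The proportion of the volume of a round sphere of dimension `m + 1` lying in a ball of
radius `s`. -/
noncomputable def sphereBallRatio (m : ℕ) (s : ℝ) : ℝ :=
  (∫ t in (0 : ℝ)..s, sin t ^ m) / ∫ t in (0 : ℝ)..π, sin t ^ m

theorem continuous_sphereBallRatio (m : ℕ) : Continuous (sphereBallRatio m) :=
  (intervalIntegral.continuous_primitive (fun a b =>
    (by fun_prop : Continuous fun t => sin t ^ m).intervalIntegrable a b) 0).div_const _

theorem sphereBallRatio_add_pi_sub (m : ℕ) (s : ℝ) :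
    sphereBallRatio m s + sphereBallRatio m (π - s) = 1 := by
  rw [sphereBallRatio, sphereBallRatio, ← add_div, integral_sin_pow_add_integral_sin_pow_pi_sub,
    div_self (integral_sin_pow_pos m).ne']

theorem sphereBallRatio_pos (m : ℕ) {s : ℝ} (hs : 0 < s) (hsπ : s ≤ π) :
    0 < sphereBallRatio m s :=
  div_pos (intervalIntegral.intervalIntegral_pos_of_pos_on
    ((by fun_prop : Continuous fun t => sin t ^ m).intervalIntegrable 0 s)
    (fun _ ht => pow_pos (sin_pos_of_pos_of_lt_pi ht.1 (ht.2.trans_le hsπ)) m) hs)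
    (integral_sin_pow_pos m)

theorem sphereBallRatio_lt_one (m : ℕ) {s : ℝ} (hs : 0 ≤ s) (hsπ : s < π) :
    sphereBallRatio m s < 1 := by
  linarith [sphereBallRatio_add_pi_sub m s,
    sphereBallRatio_pos m (sub_pos.2 hsπ) (sub_le_self π hs)]

theorem integral_one_sub_sphereBallRatio (m : ℕ) :
    ∫ s in (0 : ℝ)..π, (1 - sphereBallRatio m s) = π / 2 := by
  have hv := continuous_sphereBallRatio m
  have h := intervalIntegral.integral_comp_sub_left (a := 0) (b := π) (sphereBallRatio m) π
  simp only [sub_self, sub_zero] at h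
  have h1 : ∀ s, 1 - sphereBallRatio m s = sphereBallRatio m (π - s) := fun s => by
    linarith [sphereBallRatio_add_pi_sub m s]
  have h2 : ∫ s in (0 : ℝ)..π, (1 - sphereBallRatio m s)
      = π - ∫ s in (0 : ℝ)..π, sphereBallRatio m s := by
    rw [intervalIntegral.integral_sub (by simp) (hv.intervalIntegrable _ _)]
    simp
  have h3 : ∫ s in (0 : ℝ)..π, (1 - sphereBallRatio m s)
      = ∫ s in (0 : ℝ)..π, sphereBallRatio m s := by
    simp only [h1, h]
  linarith

theorem integral_one_sub_sphereBallRatio_lt (m : ℕ) {r : ℝ} (hr : 0 ≤ r) (hrπ : r < π) :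
    ∫ s in (0 : ℝ)..r, (1 - sphereBallRatio m s) < π / 2 := by
  have hi : ∀ a b : ℝ, IntervalIntegrable (fun s => 1 - sphereBallRatio m s) volume a b :=
    fun a b => (continuous_const.sub (continuous_sphereBallRatio m)).intervalIntegrable a b
  rw [← integral_one_sub_sphereBallRatio m,
    ← intervalIntegral.integral_add_adjacent_intervals (hi 0 r) (hi r π)]
  exact lt_add_of_pos_right _ (intervalIntegral.intervalIntegral_pos_of_pos_on (hi r π)
    (fun s hs => sub_pos.2 (sphereBallRatio_lt_one m (hr.trans hs.1.le) hs.2)) hrπ)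

/-- Rigidity step (part II of the sphere theorem): under the hypotheses of the
mean-distance bound, if the mean distance `md(X) = ∫_{X×X} d dμ⊗dμ` equals `π/2`,
then every point `x ∈ X` admits a point `x'` with `d(x,x') = π`; in particular the
radius `rad(X,d) = ⨅ x, ⨆ y, d(x,y)` equals `π`. -/
theorem mean_distance_eq_rigidity {X : Type*} [MetricSpace X] [CompactSpace X]
    [MeasurableSpace X] [BorelSpace X]
    (μ : Measure X) [IsProbabilityMeasure μ] [μ.IsOpenPosMeasure]
    (n : ℕ) (hn : 2 ≤ n)
    (hdiam : Metric.diam (Set.univ : Set X) ≤ π)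
    (hball : ∀ (x : X), ∀ s ∈ Set.Icc (0 : ℝ) π,
      (∫ t in (0 : ℝ)..s, Real.sin t ^ (n - 1))
          / (∫ t in (0 : ℝ)..π, Real.sin t ^ (n - 1))
        ≤ (μ (Metric.closedBall x s)).toReal)
    (hmd : ∫ p : X × X, dist p.1 p.2 ∂(μ.prod μ) = π / 2) :
    (∀ x : X, ∃ x' : X, dist x x' = π) ∧ (⨅ x : X, ⨆ y : X, dist x y) = π := by
  have : SecondCountableTopology X := EMetric.secondCountable_of_sigmaCompact X
  have : Nonempty X := nonempty_of_isProbabilityMeasure μ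
  have hle : ∀ x y : X, dist x y ≤ π := fun x y =>
    (dist_le_diam_of_mem isCompact_univ.isBounded (Set.mem_univ x) (Set.mem_univ y)).trans hdiam
  have hbound : ∀ (x : X) (r : ℝ), r ≤ π → (∀ y, dist x y ≤ r) →
      ∫ y, dist x y ∂μ ≤ ∫ s in (0 : ℝ)..r, (1 - sphereBallRatio (n - 1) s) :=
    fun x r hrπ hr => integral_dist_le_of_le_measureReal_closedBall μ
      (continuous_sphereBallRatio _) (dist_nonneg.trans (hr x)) hr
      fun s hs => hball x s ⟨hs.1, hs.2.trans hrπ⟩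
  set f : X → ℝ := fun x => ∫ y, dist x y ∂μ
  have hf_le : ∀ x, f x ≤ π / 2 := fun x =>
    (hbound x π le_rfl (hle x)).trans_eq (integral_one_sub_sphereBallRatio _)
  have hf_cont : Continuous f := continuous_parametric_integral_of_continuous
    (by fun_prop : Continuous (Function.uncurry fun x y : X => dist x y)) isCompact_univ
      |> fun h => by simpa using h
  have hf_int : Integrable f μ :=
    hf_cont.integrable_of_hasCompactSupport (HasCompactSupport.of_compactSpace _)
  have hd_int : Integrable (fun p : X × X => dist p.1 p.2) (μ.prod μ) :=
    continuous_dist.integrable_of_hasCompactSupport (HasCompactSupport.of_compactSpace _)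
  have hf_eq : ∀ x, f x = π / 2 := by
    intro x
    by_contra hx
    have hpos : 0 < ∫ x, (π / 2 - f x) ∂μ :=
      (by fun_prop : Continuous fun x => π / 2 - f x)
        |>.integral_pos_of_hasCompactSupport_nonneg_nonzero (x := x)
          (HasCompactSupport.of_compactSpace _) (fun y => sub_nonneg.2 (hf_le y))
          (sub_ne_zero.2 (Ne.symm hx))
    rw [integral_sub (integrable_const _) hf_int, ← integral_prod _ hd_int, hmd] at hpos
    simp at hpos
  have hanti : ∀ x : X, ∃ x' : X, dist x x' = π := by
    intro x
    obtain ⟨y, -, hy⟩ := isCompact_univ.exists_isMaxOn Set.univ_nonempty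
      (by fun_prop : ContinuousOn (fun y => dist x y) Set.univ)
    refine ⟨y, (hle x y).antisymm ?_⟩
    by_contra! hlt
    have h1 := hbound x (dist x y) hlt.le fun z => hy (Set.mem_univ z)
    have h2 := integral_one_sub_sphereBallRatio_lt (n - 1) (dist_nonneg (x := x) (y := y)) hlt
    exact (h1.trans_lt h2).ne (hf_eq x)
  refine ⟨hanti, ?_⟩
  have hsup : ∀ x : X, ⨆ y, dist x y = π := by
    intro x
    obtain ⟨y, hy⟩ := hanti x
    refine (ciSup_le (hle x)).antisymm (hy ▸ le_ciSup (f := fun y => dist x y) ?_ y)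
    exact ⟨π, Set.forall_mem_range.2 (hle x)⟩
  simp [hsup]
end

section
/- Let (X,d) be a compact metric space and μ a Borel probability measure on X with full support. Let n ≥ 2 be an integer and set v_n(s) := (∫_0^s (sin t)^{n−1} dt)/(∫_0^π (sin t)^{n−1} dt) for s ∈ [0,π]. Assume diam(X,d) ≤ π and μ(B_s(x)) ≥ v_n(s) for every x ∈ X and every s ∈ [0,π], where B_s(x) is the closed ball of radius s around x. Let 0 < ε < π. If x ∈ X satisfies D(x) := sup_{y∈X} d(x,y) ≤ π − ε, then ∫_X d(x,y) dμ(y) ≤ π/2 − δ(ε,n), where δ(ε,n) := ∫_{π−ε}^{π} (1 − v_n(s)) ds > 0. -/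
open MeasureTheory Metric Real

/-- The normalised primitive `s ↦ (∫₀ˢ f) / (∫₀ᵃ f)` of a continuous function is continuous. -/
theorem continuous_normalised_primitive {f : ℝ → ℝ} (hf : Continuous f) (a : ℝ) :
    Continuous fun s => (∫ t in (0 : ℝ)..s, f t) / (∫ t in (0 : ℝ)..a, f t) :=
  (intervalIntegral.continuous_primitive
    (fun b c => hf.intervalIntegrable b c) 0).div_const _

/-- If `f` is symmetric about `a / 2`, the complement of its normalised primitive has mean `1 / 2`
on `[0, a]`. -/
theorem integral_one_sub_normalised_primitive {f : ℝ → ℝ} (hf : Continuous f) {a : ℝ}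
    (hsymm : ∀ t, f (a - t) = f t) (ha : (∫ t in (0 : ℝ)..a, f t) ≠ 0) :
    ∫ s in (0 : ℝ)..a, (1 - (∫ t in (0 : ℝ)..s, f t) / (∫ t in (0 : ℝ)..a, f t)) = a / 2 := by
  have hv := continuous_normalised_primitive hf a
  have hreflect : ∀ s, (∫ t in (0 : ℝ)..(a - s), f t) / (∫ t in (0 : ℝ)..a, f t)
      = 1 - (∫ t in (0 : ℝ)..s, f t) / (∫ t in (0 : ℝ)..a, f t) := by
    intro s
    have h₁ : ∫ t in (a - s)..a, f t = ∫ t in (0 : ℝ)..s, f t := by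
      have h := intervalIntegral.integral_comp_sub_left (a := 0) (b := s) f a
      simp only [hsymm, sub_zero] at h
      exact h.symm
    have h₂ := intervalIntegral.integral_add_adjacent_intervals
      (hf.intervalIntegrable (μ := volume) 0 (a - s)) (hf.intervalIntegrable (a - s) a)
    rw [eq_sub_iff_add_eq, ← add_div, ← h₁, h₂, div_self ha]
  have h₁ := intervalIntegral.integral_comp_sub_left (a := 0) (b := a)
    (fun s => (∫ t in (0 : ℝ)..s, f t) / (∫ t in (0 : ℝ)..a, f t)) a
  simp only [hreflect, sub_self, sub_zero] at h₁
  have h₂ := intervalIntegral.integral_sub (μ := volume) (a := 0) (b := a)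
    (continuous_const (y := (1 : ℝ)).intervalIntegrable _ _) (hv.intervalIntegrable _ _)
  rw [intervalIntegral.integral_const, smul_eq_mul] at h₂
  linarith

/-- The mean of a distance function bounded by `R` is at most `∫₀ᴿ (1 - v)` for any continuous
lower bound `v` of the measures of closed balls. -/
theorem integral_dist_le_of_le_measure_closedBall {X : Type*} [MetricSpace X] [CompactSpace X]
    [MeasurableSpace X] [BorelSpace X] (μ : Measure X) [IsProbabilityMeasure μ] {x : X} {R : ℝ}
    (hR : 0 ≤ R) (hdist : ∀ y, dist x y ≤ R) {v : ℝ → ℝ} (hv : Continuous v)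
    (hball : ∀ s ∈ Set.Icc 0 R, v s ≤ (μ (closedBall x s)).toReal) :
    ∫ y, dist x y ∂μ ≤ ∫ s in (0 : ℝ)..R, (1 - v s) := by
  have hcont : Continuous fun y => dist x y := by fun_prop
  have hint : Integrable (fun y => dist x y) μ :=
    hcont.integrable_of_hasCompactSupport (HasCompactSupport.of_compactSpace _)
  rw [hint.integral_eq_integral_Ioc_meas_le (ae_of_all _ fun _ => dist_nonneg)
    (ae_of_all _ hdist), intervalIntegral.integral_of_le hR]
  refine setIntegral_mono_ae_restrict ?_ ?_ ?_
  · have hanti : Antitone fun t => μ.real {a | t ≤ dist x a} := fun s t hst =>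
      measureReal_mono fun a (ha : t ≤ dist x a) => hst.trans ha
    exact (intervalIntegrable_iff_integrableOn_Ioc_of_le hR).1 hanti.intervalIntegrable
  · exact (intervalIntegrable_iff_integrableOn_Ioc_of_le hR).1
      ((continuous_const.sub hv).intervalIntegrable _ _)
  · filter_upwards [ae_restrict_of_ae (meas_le_ae_eq_meas_lt μ volume fun y => dist x y),
      ae_restrict_mem measurableSet_Ioc] with t ht hmem
    have hcompl : {a | t < dist x a} = (closedBall x t)ᶜ := by
      ext a
      simp [dist_comm]
    rw [measureReal_def, ht, hcompl, ← measureReal_def,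
      probReal_compl_eq_one_sub isClosed_closedBall.measurableSet]
    exact sub_le_sub_left (hball t (Set.Ioc_subset_Icc_self hmem)) 1

/-- Quantitative pointwise estimate (main step of part III of the sphere theorem):
under the standing hypotheses, for `0 < ε < π`, if `x ∈ X` satisfies
`D(x) = ⨆ y, d(x,y) ≤ π - ε`, then `∫ y, d(x,y) dμ(y) ≤ π/2 - δ(ε,n)` where
`δ(ε,n) = ∫_{π-ε}^{π} (1 - v n s) ds > 0` and
`v n s = (∫₀^s sin t ^ (n-1) dt)/(∫₀^π sin t ^ (n-1) dt)`. -/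
theorem pointwise_mean_distance_gap {X : Type*} [MetricSpace X] [CompactSpace X]
    [MeasurableSpace X] [BorelSpace X]
    (μ : Measure X) [IsProbabilityMeasure μ] [μ.IsOpenPosMeasure]
    (n : ℕ) (hn : 2 ≤ n)
    (hdiam : Metric.diam (Set.univ : Set X) ≤ π)
    (hball : ∀ (x : X), ∀ s ∈ Set.Icc (0 : ℝ) π,
      (∫ t in (0 : ℝ)..s, Real.sin t ^ (n - 1))
          / (∫ t in (0 : ℝ)..π, Real.sin t ^ (n - 1))
        ≤ (μ (Metric.closedBall x s)).toReal)
    (ε : ℝ) (hε0 : 0 < ε) (hεπ : ε < π)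
    (x : X) (hx : (⨆ y : X, dist x y) ≤ π - ε) :
    0 < (∫ s in (π - ε)..π,
          (1 - (∫ t in (0 : ℝ)..s, Real.sin t ^ (n - 1))
                / (∫ t in (0 : ℝ)..π, Real.sin t ^ (n - 1))))
    ∧ ∫ y, dist x y ∂μ
        ≤ π / 2 - ∫ s in (π - ε)..π,
            (1 - (∫ t in (0 : ℝ)..s, Real.sin t ^ (n - 1))
                  / (∫ t in (0 : ℝ)..π, Real.sin t ^ (n - 1))) := by
  have hf : Continuous fun t : ℝ => sin t ^ (n - 1) := by fun_prop
  have hsymm : ∀ t, sin (π - t) ^ (n - 1) = sin t ^ (n - 1) := fun t => by rw [sin_pi_sub]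
  have hv := continuous_normalised_primitive hf π
  have hw : Continuous fun s => 1 - (∫ t in (0 : ℝ)..s, sin t ^ (n - 1))
      / (∫ t in (0 : ℝ)..π, sin t ^ (n - 1)) := continuous_const.sub hv
  have hpos : 0 < ∫ t in (0 : ℝ)..π, sin t ^ (n - 1) := integral_sin_pow_pos _
  constructor
  · refine intervalIntegral.intervalIntegral_pos_of_pos_on (hw.intervalIntegrable _ _) ?_
      (by linarith)
    rintro s ⟨hs, hsπ⟩
    have htail : 0 < ∫ t in s..π, sin t ^ (n - 1) :=
      intervalIntegral.intervalIntegral_pos_of_pos_on (hf.intervalIntegrable _ _)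
        (fun t ht => pow_pos (sin_pos_of_pos_of_lt_pi (by linarith [ht.1]) ht.2) _) hsπ
    have hsplit := intervalIntegral.integral_add_adjacent_intervals
      (hf.intervalIntegrable (μ := volume) 0 s) (hf.intervalIntegrable s π)
    rw [sub_pos, div_lt_one hpos]
    linarith
  · have hbdd : BddAbove (Set.range fun y : X => dist x y) :=
      (isCompact_range (by fun_prop)).bddAbove
    have hmean := integral_dist_le_of_le_measure_closedBall μ (sub_nonneg.2 hεπ.le)
      (fun y => (le_ciSup hbdd y).trans hx) hv
      (fun s hs => hball x s ⟨hs.1, hs.2.trans (by linarith)⟩)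
    have hsplit := intervalIntegral.integral_add_adjacent_intervals
      (hw.intervalIntegrable (μ := volume) 0 (π - ε)) (hw.intervalIntegrable (π - ε) π)
    rw [integral_one_sub_normalised_primitive hf hsymm hpos.ne'] at hsplit
    linarith
end

section
/- Let (X,d) be a compact metric space and μ a Borel probability measure on X with full support. Let n ≥ 2 be an integer and set v_n(s) := (∫_0^s (sin t)^{n−1} dt)/(∫_0^π (sin t)^{n−1} dt) for s ∈ [0,π]. Assume diam(X,d) ≤ π and μ(B_s(x)) ≥ v_n(s) for every x ∈ X and every s ∈ [0,π], where B_s(x) is the closed ball of radius s around x. Let 0 < ε < π and set δ(ε,n) := ∫_{π−ε}^{π} (1 − v_n(s)) ds. If rad(X,d) := inf_{x∈X} sup_{y∈X} d(x,y) < π − ε, then md(X) := ∫_{X×X} d(x,y) dμ(x)dμ(y) < π/2 − v_n(ε/2)·δ(ε/2,n). Consequently, if md(X) ≥ π/2 − v_n(ε/2)·δ(ε/2,n) then rad(X,d) ≥ π − ε. -/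
open MeasureTheory Metric Real

/-- The normalized primitive of `sin ^ k` on `[0, π]`; for `k = n - 1` this is the normalized volume
of a ball of radius `s` in the round sphere `S^n`. -/
noncomputable def sinPowRatio (k : ℕ) (s : ℝ) : ℝ :=
  (∫ t in (0 : ℝ)..s, Real.sin t ^ k) / (∫ t in (0 : ℝ)..π, Real.sin t ^ k)

theorem intervalIntegrable_sin_pow (k : ℕ) (a b : ℝ) :
    IntervalIntegrable (fun t => Real.sin t ^ k) volume a b :=
  (Real.continuous_sin.pow k).intervalIntegrable a b

theorem integral_sin_pow_pos_of_lt (k : ℕ) {a b : ℝ} (ha : 0 ≤ a) (hab : a < b) (hb : b ≤ π) :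
    0 < ∫ t in a..b, Real.sin t ^ k :=
  intervalIntegral.intervalIntegral_pos_of_pos_on (intervalIntegrable_sin_pow k a b)
    (fun _ ht => pow_pos (Real.sin_pos_of_pos_of_lt_pi (ha.trans_lt ht.1) (ht.2.trans_le hb)) k) hab

theorem continuous_sinPowRatio (k : ℕ) : Continuous (sinPowRatio k) :=
  (intervalIntegral.continuous_primitive (intervalIntegrable_sin_pow k) 0).div_const _

theorem sinPowRatio_pos (k : ℕ) {s : ℝ} (hs : 0 < s) (hsπ : s ≤ π) : 0 < sinPowRatio k s :=
  div_pos (integral_sin_pow_pos_of_lt k le_rfl hs hsπ)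
    (integral_sin_pow_pos_of_lt k le_rfl Real.pi_pos le_rfl)

theorem sinPowRatio_pi_sub (k : ℕ) (s : ℝ) : sinPowRatio k (π - s) = 1 - sinPowRatio k s := by
  have hpos := integral_sin_pow_pos_of_lt k le_rfl Real.pi_pos le_rfl
  have hreflect : ∫ t in (0 : ℝ)..(π - s), Real.sin t ^ k = ∫ t in s..π, Real.sin t ^ k := by
    have h := intervalIntegral.integral_comp_sub_left (a := 0) (b := π - s)
      (fun t => Real.sin t ^ k) π
    simpa [Real.sin_pi_sub] using h
  have hadd := intervalIntegral.integral_add_adjacent_intervals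
    (intervalIntegrable_sin_pow k 0 s) (intervalIntegrable_sin_pow k s π)
  rw [sinPowRatio, sinPowRatio, hreflect, ← hadd]
  rw [← hadd] at hpos
  field_simp
  ring

theorem sinPowRatio_lt_one (k : ℕ) {s : ℝ} (hs : 0 ≤ s) (hsπ : s < π) : sinPowRatio k s < 1 := by
  have h := sinPowRatio_pos k (s := π - s) (by linarith) (by linarith)
  rw [sinPowRatio_pi_sub] at h
  linarith

theorem continuous_one_sub_sinPowRatio (k : ℕ) : Continuous fun s => 1 - sinPowRatio k s :=
  continuous_const.sub (continuous_sinPowRatio k)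

theorem integral_one_sub_sinPowRatio (k : ℕ) :
    ∫ s in (0 : ℝ)..π, (1 - sinPowRatio k s) = π / 2 := by
  have hreflect : ∫ s in (0 : ℝ)..π, (1 - sinPowRatio k s) = ∫ s in (0 : ℝ)..π, sinPowRatio k s := by
    have h := intervalIntegral.integral_comp_sub_left (a := 0) (b := π) (sinPowRatio k) π
    simpa [sinPowRatio_pi_sub] using h
  have hsub : ∫ s in (0 : ℝ)..π, (1 - sinPowRatio k s)
      = π - ∫ s in (0 : ℝ)..π, sinPowRatio k s := by
    rw [intervalIntegral.integral_sub intervalIntegrable_const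
      ((continuous_sinPowRatio k).intervalIntegrable 0 π)]
    simp
  linarith

section MeanDistance

variable {X : Type*} [MetricSpace X] [CompactSpace X] [MeasurableSpace X] [BorelSpace X]
  (μ : Measure X) [IsProbabilityMeasure μ]

theorem integrable_dist_prod : Integrable (fun p : X × X => dist p.1 p.2) (μ.prod μ) :=
  continuous_dist.integrable_of_hasCompactSupport (HasCompactSupport.of_compactSpace _)

theorem integrable_dist_left (x : X) : Integrable (fun y => dist x y) μ :=
  (continuous_const.dist continuous_id).integrable_of_hasCompactSupport
    (HasCompactSupport.of_compactSpace _)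

theorem integral_dist_eq_of_le {x : X} {M : ℝ} (hM : 0 ≤ M) (hx : ∀ y, dist x y ≤ M) :
    ∫ y, dist x y ∂μ = ∫ s in (0 : ℝ)..M, (1 - μ.real (closedBall x s)) := by
  have hcompl (s : ℝ) : {y | s < dist x y} = (closedBall x s)ᶜ := by
    ext y
    simp [dist_comm]
  rw [(integrable_dist_left μ x).integral_eq_integral_meas_lt (.of_forall fun _ => dist_nonneg),
    intervalIntegral.integral_of_le hM]
  simp_rw [hcompl, probReal_compl_eq_one_sub isClosed_closedBall.measurableSet]
  refine setIntegral_eq_of_subset_of_forall_sdiff_eq_zero measurableSet_Ioi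
    Set.Ioc_subset_Ioi_self fun s hs => ?_
  have hMs : M < s := by
    by_contra! h
    exact hs.2 ⟨hs.1, h⟩
  have huniv : closedBall x s = Set.univ :=
    Set.eq_univ_of_forall fun y => by
      rw [mem_closedBall, dist_comm]
      exact (hx y).trans hMs.le
  simp [huniv]

theorem integral_dist_le_of_sinPowRatio_le {k : ℕ} {x : X}
    (hball : ∀ s ∈ Set.Icc (0 : ℝ) π, sinPowRatio k s ≤ μ.real (closedBall x s))
    {M : ℝ} (hM : 0 ≤ M) (hMπ : M ≤ π) (hx : ∀ y, dist x y ≤ M) :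
    ∫ y, dist x y ∂μ ≤ ∫ s in (0 : ℝ)..M, (1 - sinPowRatio k s) := by
  rw [integral_dist_eq_of_le μ hM hx]
  have hanti : Antitone fun s => 1 - μ.real (closedBall x s) := fun s t hst =>
    sub_le_sub_left (measureReal_mono (closedBall_subset_closedBall hst)) 1
  exact intervalIntegral.integral_mono_on hM hanti.intervalIntegrable
    ((continuous_one_sub_sinPowRatio k).intervalIntegrable 0 M)
    fun s hs => sub_le_sub_left (hball s ⟨hs.1, hs.2.trans hMπ⟩) 1

theorem integral_dist_lt_of_radius_lt {k : ℕ}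
    (hdiam : Metric.diam (Set.univ : Set X) ≤ π)
    (hball : ∀ x : X, ∀ s ∈ Set.Icc (0 : ℝ) π, sinPowRatio k s ≤ μ.real (closedBall x s))
    {ε : ℝ} (hε0 : 0 < ε) (hεπ : ε < π) (hrad : (⨅ x : X, ⨆ y : X, dist x y) < π - ε) :
    ∫ p : X × X, dist p.1 p.2 ∂(μ.prod μ)
      < π / 2 - sinPowRatio k (ε / 2) * ∫ s in (π - ε / 2)..π, (1 - sinPowRatio k s) := by
  have : Nonempty X := nonempty_of_isProbabilityMeasure μ
  have hii (a b : ℝ) := (continuous_one_sub_sinPowRatio k).intervalIntegrable (μ := volume) a b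
  obtain ⟨x₀, hx₀⟩ := exists_lt_of_ciInf_lt hrad
  set R := ⨆ y : X, dist x₀ y
  have hle (y : X) : dist x₀ y ≤ R :=
    le_ciSup (isCompact_range (continuous_const.dist continuous_id)).bddAbove y
  have hR0 : 0 ≤ R := dist_nonneg.trans (hle x₀)
  set c := ∫ s in (R + ε / 2)..π, (1 - sinPowRatio k s) with hc
  have hglobal (x : X) : ∫ y, dist x y ∂μ ≤ π / 2 := by
    rw [← integral_one_sub_sinPowRatio k]
    exact integral_dist_le_of_sinPowRatio_le μ (hball x) Real.pi_pos.le le_rfl fun y =>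
      (dist_le_diam_of_mem isCompact_univ.isBounded (Set.mem_univ x) (Set.mem_univ y)).trans hdiam
  have hlocal (x : X) (hx : x ∈ closedBall x₀ (ε / 2)) : ∫ y, dist x y ∂μ ≤ π / 2 - c := by
    rw [← integral_one_sub_sinPowRatio k, hc,
      ← intervalIntegral.integral_add_adjacent_intervals (hii 0 (R + ε / 2)) (hii _ π),
      add_sub_cancel_right]
    refine integral_dist_le_of_sinPowRatio_le μ (hball x) (by linarith) (by linarith) fun y => ?_
    linarith [dist_triangle x x₀ y, hle y, mem_closedBall.1 hx]
  have hδc : ∫ s in (π - ε / 2)..π, (1 - sinPowRatio k s) < c := by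
    rw [hc, ← intervalIntegral.integral_add_adjacent_intervals
      (hii (R + ε / 2) (π - ε / 2)) (hii _ π), lt_add_iff_pos_left]
    exact intervalIntegral.intervalIntegral_pos_of_pos_on (hii _ _)
      (fun s hs => sub_pos.2 (sinPowRatio_lt_one k (by linarith [hs.1]) (by linarith [hs.2])))
      (by linarith)
  have hc0 : 0 ≤ c :=
    intervalIntegral.integral_nonneg (by linarith) fun s hs => by
      have h : 1 - sinPowRatio k s = sinPowRatio k (π - s) := (sinPowRatio_pi_sub k s).symm
      rw [h]
      rcases hs.2.eq_or_lt with rfl | hlt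
      · simp [sinPowRatio]
      · exact (sinPowRatio_pos k (by linarith) (by linarith [hs.1])).le
  have hmeas : MeasurableSet (closedBall x₀ (ε / 2)) := isClosed_closedBall.measurableSet
  have hint : Integrable ((closedBall x₀ (ε / 2)).indicator fun _ => c) μ :=
    (integrable_const c).indicator hmeas
  calc ∫ p : X × X, dist p.1 p.2 ∂(μ.prod μ)
      = ∫ x, ∫ y, dist x y ∂μ ∂μ := integral_prod _ (integrable_dist_prod μ)
    _ ≤ ∫ x, (π / 2 - (closedBall x₀ (ε / 2)).indicator (fun _ => c) x) ∂μ := by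
        refine integral_mono (integrable_dist_prod μ).integral_prod_left
          ((integrable_const _).sub hint) fun x => ?_
        by_cases hx : x ∈ closedBall x₀ (ε / 2)
        · simpa only [Set.indicator_of_mem hx] using hlocal x hx
        · simpa only [Set.indicator_of_notMem hx, sub_zero] using hglobal x
    _ = π / 2 - μ.real (closedBall x₀ (ε / 2)) * c := by
        rw [integral_sub (integrable_const _) hint, integral_indicator_const c hmeas]
        simp
    _ ≤ π / 2 - sinPowRatio k (ε / 2) * c :=
        sub_le_sub_left (mul_le_mul_of_nonneg_right
          (hball x₀ (ε / 2) ⟨by linarith, by linarith⟩) hc0) _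
    _ < _ := sub_lt_sub_left (mul_lt_mul_of_pos_left hδc
        (sinPowRatio_pos k (by linarith) (by linarith))) _

end MeanDistance

/-- Quantitative estimate for part III of the sphere theorem: under the standing
hypotheses, with `v n s = (∫₀^s sin t ^ (n-1) dt)/(∫₀^π sin t ^ (n-1) dt)` and
`δ(ε,n) = ∫_{π-ε}^{π} (1 - v n s) ds`, if `rad(X,d) = ⨅ x, ⨆ y, d(x,y) < π - ε`,
then `md(X) = ∫_{X×X} d dμ⊗dμ < π/2 - v n (ε/2) · δ(ε/2,n)`; consequently
`md(X) ≥ π/2 - v n (ε/2) · δ(ε/2,n)` implies `rad(X,d) ≥ π - ε`. -/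
theorem mean_distance_radius_estimate {X : Type*} [MetricSpace X] [CompactSpace X]
    [MeasurableSpace X] [BorelSpace X]
    (μ : Measure X) [IsProbabilityMeasure μ] [μ.IsOpenPosMeasure]
    (n : ℕ) (hn : 2 ≤ n)
    (hdiam : Metric.diam (Set.univ : Set X) ≤ π)
    (hball : ∀ (x : X), ∀ s ∈ Set.Icc (0 : ℝ) π,
      (∫ t in (0 : ℝ)..s, Real.sin t ^ (n - 1))
          / (∫ t in (0 : ℝ)..π, Real.sin t ^ (n - 1))
        ≤ (μ (Metric.closedBall x s)).toReal)
    (ε : ℝ) (hε0 : 0 < ε) (hεπ : ε < π) :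
    ((⨅ x : X, ⨆ y : X, dist x y) < π - ε →
      ∫ p : X × X, dist p.1 p.2 ∂(μ.prod μ)
        < π / 2 -
          ((∫ t in (0 : ℝ)..(ε / 2), Real.sin t ^ (n - 1))
              / (∫ t in (0 : ℝ)..π, Real.sin t ^ (n - 1)))
            * ∫ s in (π - ε / 2)..π,
                (1 - (∫ t in (0 : ℝ)..s, Real.sin t ^ (n - 1))
                      / (∫ t in (0 : ℝ)..π, Real.sin t ^ (n - 1))))
    ∧ (π / 2 -
          ((∫ t in (0 : ℝ)..(ε / 2), Real.sin t ^ (n - 1))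
              / (∫ t in (0 : ℝ)..π, Real.sin t ^ (n - 1)))
            * (∫ s in (π - ε / 2)..π,
                (1 - (∫ t in (0 : ℝ)..s, Real.sin t ^ (n - 1))
                      / (∫ t in (0 : ℝ)..π, Real.sin t ^ (n - 1))))
        ≤ ∫ p : X × X, dist p.1 p.2 ∂(μ.prod μ) →
      π - ε ≤ ⨅ x : X, ⨆ y : X, dist x y) := by
  have key := integral_dist_lt_of_radius_lt μ (k := n - 1) hdiam hball hε0 hεπ
  exact ⟨key, fun h => le_of_not_gt fun hrad => (key hrad).not_ge h⟩
end

section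
/- Let (X,d) be a compact metric space and μ a Borel probability measure on X with full support. Let n ≥ 2 be an integer and set v_n(s) := (∫_0^s (sin t)^{n−1} dt)/(∫_0^π (sin t)^{n−1} dt) for s ∈ [0,π]. Assume diam(X,d) ≤ π and μ(B_s(x)) ≥ v_n(s) for every x ∈ X and every s ∈ [0,π], where B_s(x) is the closed ball of radius s around x. Let f : [0,π] → ℝ be continuous and strictly increasing. Then for every x ∈ X, ∫_X f(d(x,y)) dμ(y) ≤ M*_{f,n} := (∫_0^π f(r)(sin r)^{n−1} dr)/(∫_0^π (sin r)^{n−1} dr). -/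
open MeasureTheory Metric Real

/-- A continuous monotone nonnegative function has larger integral against a stochastically
larger probability measure. -/
theorem lintegral_le_lintegral_of_measure_Iic_le {ν ρ : Measure ℝ} [IsProbabilityMeasure ν]
    [IsProbabilityMeasure ρ] (h : ∀ s, ρ (Set.Iic s) ≤ ν (Set.Iic s)) {g : ℝ → ℝ}
    (hg : Monotone g) (hgc : Continuous g) (hg0 : ∀ r, 0 ≤ g r) :
    ∫⁻ r, ENNReal.ofReal (g r) ∂ν ≤ ∫⁻ r, ENNReal.ofReal (g r) ∂ρ := by
  rw [lintegral_eq_lintegral_meas_lt ν (.of_forall hg0) hgc.aemeasurable,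
    lintegral_eq_lintegral_meas_lt ρ (.of_forall hg0) hgc.aemeasurable]
  refine lintegral_mono fun t => ?_
  have hcompl : {r | t < g r} = {r | g r ≤ t}ᶜ := by ext r; simp
  have hclosed : IsClosed {r | g r ≤ t} := isClosed_le hgc continuous_const
  rw [hcompl, prob_compl_eq_one_sub hclosed.measurableSet,
    prob_compl_eq_one_sub hclosed.measurableSet]
  refine tsub_le_tsub_left ?_ 1
  rcases Set.eq_empty_or_nonempty {r | g r ≤ t} with he | hne
  · simp [he]
  by_cases hb : BddAbove {r | g r ≤ t}
  · have hIic : {r | g r ≤ t} = Set.Iic (sSup {r | g r ≤ t}) :=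
      Set.Subset.antisymm (fun r hr => le_csSup hb hr)
        fun r hr => (hg hr).trans (hclosed.csSup_mem hne hb)
    rw [hIic]
    exact h _
  · have huniv : {r | g r ≤ t} = Set.univ := by
      refine Set.eq_univ_of_forall fun r => ?_
      obtain ⟨q, hq, hrq⟩ := not_bddAbove_iff.1 hb r
      exact (hg hrq.le).trans hq
    simp [huniv]

/-- A bounded continuous monotone function has larger integral against a stochastically larger
probability measure. -/
theorem integral_le_integral_of_measure_Iic_le {ν ρ : Measure ℝ} [IsProbabilityMeasure ν]
    [IsProbabilityMeasure ρ] (h : ∀ s, ρ (Set.Iic s) ≤ ν (Set.Iic s)) {g : ℝ → ℝ}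
    (hg : Monotone g) (hgc : Continuous g) {a b : ℝ} (hab : ∀ r, g r ∈ Set.Icc a b) :
    ∫ r, g r ∂ν ≤ ∫ r, g r ∂ρ := by
  have hint (κ : Measure ℝ) [IsProbabilityMeasure κ] : Integrable g κ :=
    .of_mem_Icc a b hgc.aemeasurable (.of_forall hab)
  have hnonneg : ∀ r, 0 ≤ g r - a := fun r => sub_nonneg.2 (hab r).1
  have hsub : ∫ r, (g r - a) ∂ν ≤ ∫ r, (g r - a) ∂ρ := by
    have hcont : Continuous fun r => g r - a := hgc.sub continuous_const
    rw [integral_eq_lintegral_of_nonneg_ae (.of_forall hnonneg) hcont.aestronglyMeasurable,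
      integral_eq_lintegral_of_nonneg_ae (.of_forall hnonneg) hcont.aestronglyMeasurable]
    refine ENNReal.toReal_mono ?_ (lintegral_le_lintegral_of_measure_Iic_le h
      (fun r s hrs => sub_le_sub_right (hg hrs) a) hcont hnonneg)
    exact ((hint ρ).sub (integrable_const a)).lintegral_lt_top.ne
  rw [integral_sub (hint ν) (integrable_const a), integral_sub (hint ρ) (integrable_const a)] at hsub
  simpa using hsub

/-- Erbar–Sturm type `f`-mean-distance inequality (pointwise form): under the standing
hypotheses (compact `X`, full-support Borel probability `μ`, `n ≥ 2`, `diam X ≤ π`,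
Bishop–Gromov inequality `μ (closedBall x s) ≥ v n s` for `s ∈ [0,π]`), for every
continuous strictly increasing `f : [0,π] → ℝ` and every `x ∈ X`,
`∫ y, f(d(x,y)) dμ(y) ≤ M*_{f,n} = (∫₀^π f r (sin r)^{n-1} dr)/(∫₀^π (sin r)^{n-1} dr)`. -/
theorem pointwise_f_mean_distance_le {X : Type*} [MetricSpace X] [CompactSpace X]
    [MeasurableSpace X] [BorelSpace X]
    (μ : Measure X) [IsProbabilityMeasure μ] [μ.IsOpenPosMeasure]
    (n : ℕ) (hn : 2 ≤ n)
    (hdiam : Metric.diam (Set.univ : Set X) ≤ π)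
    (hball : ∀ (x : X), ∀ s ∈ Set.Icc (0 : ℝ) π,
      (∫ t in (0 : ℝ)..s, Real.sin t ^ (n - 1))
          / (∫ t in (0 : ℝ)..π, Real.sin t ^ (n - 1))
        ≤ (μ (Metric.closedBall x s)).toReal)
    (f : ℝ → ℝ) (hfc : ContinuousOn f (Set.Icc 0 π))
    (hfm : StrictMonoOn f (Set.Icc 0 π))
    (x : X) :
    ∫ y, f (dist x y) ∂μ
      ≤ (∫ r in (0 : ℝ)..π, f r * Real.sin r ^ (n - 1))
          / (∫ r in (0 : ℝ)..π, Real.sin r ^ (n - 1)) := by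
  have hcont : Continuous fun t : ℝ => sin t ^ (n - 1) := by fun_prop
  set I : ℝ := ∫ t in (0 : ℝ)..π, sin t ^ (n - 1)
  have hI : 0 < I := integral_sin_pow_pos _
  set w : ℝ → ℝ := fun t => sin t ^ (n - 1) / I with hw
  have hwc : Continuous w := hcont.div_const I
  have hw0 : ∀ t ∈ Set.Icc 0 π, 0 ≤ w t := fun t ht =>
    div_nonneg (pow_nonneg (sin_nonneg_of_mem_Icc ht) _) hI.le
  set ρ : Measure ℝ :=
    (volume.restrict (Set.Ioc 0 π)).withDensity fun t => ENNReal.ofReal (w t) with hρ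
  have hρIic : ∀ s ∈ Set.Icc 0 π,
      ρ (Set.Iic s) = ENNReal.ofReal ((∫ t in (0 : ℝ)..s, sin t ^ (n - 1)) / I) := by
    intro s hs
    rw [hρ, withDensity_apply _ measurableSet_Iic, Measure.restrict_restrict measurableSet_Iic,
      Set.inter_comm, Set.Ioc_inter_Iic, min_eq_right hs.2, ← intervalIntegral.integral_div,
      intervalIntegral.integral_of_le hs.1,
      ofReal_integral_eq_lintegral_ofReal (hwc.integrableOn_Ioc)]
    exact (ae_restrict_iff' measurableSet_Ioc).2
      (.of_forall fun t ht => hw0 t ⟨ht.1.le, ht.2.trans hs.2⟩)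
  have hρuniv : ρ Set.univ = 1 := by
    have hπ := hρIic π ⟨pi_pos.le, le_rfl⟩
    rw [div_self hI.ne', ENNReal.ofReal_one] at hπ
    rw [← hπ, hρ, withDensity_apply _ .univ, withDensity_apply _ measurableSet_Iic,
      Measure.restrict_restrict .univ, Measure.restrict_restrict measurableSet_Iic,
      Set.univ_inter, Set.inter_eq_right.2 fun t ht => ht.2]
  have : IsProbabilityMeasure ρ := ⟨hρuniv⟩
  have hdist : ∀ y, dist x y ∈ Set.Icc 0 π := fun y =>
    ⟨dist_nonneg, (dist_le_diam_of_mem isCompact_univ.isBounded trivial trivial).trans hdiam⟩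
  have hdc : Continuous (dist x) := by fun_prop
  set ν : Measure ℝ := μ.map (dist x) with hν
  have : IsProbabilityMeasure ν := Measure.isProbabilityMeasure_map hdc.aemeasurable
  have hle : ∀ s, ρ (Set.Iic s) ≤ ν (Set.Iic s) := by
    intro s
    rcases lt_or_ge s 0 with hs0 | hs0
    · have hempty : Set.Iic s ∩ Set.Ioc 0 π = ∅ :=
        Set.eq_empty_of_forall_notMem fun t ht => absurd (ht.1.trans_lt hs0) ht.2.1.not_gt
      rw [hρ, withDensity_apply _ measurableSet_Iic, Measure.restrict_restrict measurableSet_Iic,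
        hempty]
      simp
    rw [hν, Measure.map_apply hdc.measurable measurableSet_Iic]
    rcases le_or_gt s π with hsπ | hsπ
    · have hpre : dist x ⁻¹' Set.Iic s = closedBall x s := by
        ext y
        simp [dist_comm]
      rw [hpre, hρIic s ⟨hs0, hsπ⟩]
      exact ENNReal.ofReal_le_of_le_toReal (hball x s ⟨hs0, hsπ⟩)
    · have hpre : dist x ⁻¹' Set.Iic s = Set.univ :=
        Set.eq_univ_of_forall fun y => (hdist y).2.trans hsπ.le
      rw [hpre, measure_univ]
      exact prob_le_one
  set g : ℝ → ℝ := Set.IccExtend pi_pos.le ((Set.Icc 0 π).domRestrict f)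
  have hgf : ∀ r ∈ Set.Icc 0 π, g r = f r := fun r hr => Set.IccExtend_of_mem _ _ hr
  have hgc : Continuous g := hfc.domRestrict.Icc_extend'
  have hgm : Monotone g := Monotone.IccExtend _ fun r s hrs => hfm.monotoneOn r.2 s.2 hrs
  have hgb : ∀ r, g r ∈ Set.Icc (f 0) (f π) := fun r =>
    have hr := (Set.projIcc 0 π pi_pos.le r).2
    ⟨hfm.monotoneOn ⟨le_rfl, pi_pos.le⟩ hr hr.1, hfm.monotoneOn hr ⟨pi_pos.le, le_rfl⟩ hr.2⟩
  have hνg : ∫ r, g r ∂ν = ∫ y, f (dist x y) ∂μ := by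
    rw [hν, integral_map hdc.aemeasurable hgc.aestronglyMeasurable]
    simp_rw [hgf _ (hdist _)]
  have hρg : ∫ r, g r ∂ρ = (∫ r in (0 : ℝ)..π, f r * sin r ^ (n - 1)) / I := by
    rw [hρ, integral_withDensity_eq_integral_toReal_smul (by fun_prop)
      (.of_forall fun _ => ENNReal.ofReal_lt_top), ← intervalIntegral.integral_div,
      intervalIntegral.integral_of_le pi_pos.le]
    refine setIntegral_congr_fun measurableSet_Ioc fun r hr => ?_
    have hr' : r ∈ Set.Icc 0 π := ⟨hr.1.le, hr.2⟩
    simp only [ENNReal.toReal_ofReal (hw0 r hr'), hgf r hr', smul_eq_mul]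
    simp only [hw]
    ring
  rw [← hνg, ← hρg]
  exact integral_le_integral_of_measure_Iic_le hle hgm hgc hgb
end

section
/- Let (X,d) be a compact metric space and μ a Borel probability measure on X with full support. Let n ≥ 2 be an integer and set v_n(s) := (∫_0^s (sin t)^{n−1} dt)/(∫_0^π (sin t)^{n−1} dt) for s ∈ [0,π]. Assume diam(X,d) ≤ π and μ(B_s(x)) ≥ v_n(s) for every x ∈ X and every s ∈ [0,π], where B_s(x) is the closed ball of radius s around x. Let f : [0,π] → ℝ be continuous and strictly increasing, and let 0 < ε < π. If x ∈ X satisfies D(x) := sup_{y∈X} d(x,y) ≤ π − ε, then ∫_X f(d(x,y)) dμ(y) ≤ M*_{f,n} − δ₁(f,ε,n), where M*_{f,n} := (∫_0^π f(r)(sin r)^{n−1} dr)/(∫_0^π (sin r)^{n−1} dr) and δ₁(f,ε,n) := ∫_{f(π−ε)}^{f(π)} (1 − v_n(f^{−1}(u))) du > 0. -/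
open MeasureTheory Metric Real

/-- Layer-cake formula for a function with values in `[a, b]`, in terms of its sublevel sets. -/
theorem integral_const_sub_eq_intervalIntegral_sublevel {Y : Type*} [MeasurableSpace Y]
    (P : Measure Y) [IsFiniteMeasure P] {h : Y → ℝ} (hm : AEStronglyMeasurable h P)
    {a b : ℝ} (hab : a ≤ b) (ha : ∀ᵐ y ∂P, a ≤ h y) (hb : ∀ᵐ y ∂P, h y ≤ b) :
    Integrable h P ∧ ∫ y, (b - h y) ∂P = ∫ u in a..b, P.real {y | h y ≤ u} := by
  have hi : Integrable h P := by
    refine Integrable.of_bound hm (max |a| |b|) ?_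
    filter_upwards [ha, hb] with y h1 h2
    exact abs_le_max_abs_abs h1 h2
  refine ⟨hi, ?_⟩
  have hi' : Integrable (fun y => b - h y) P := (integrable_const b).sub hi
  rw [hi'.integral_eq_integral_Ioc_meas_le (M := b - a)
    (by filter_upwards [hb] with y hy; simpa using hy)
    (by filter_upwards [ha] with y hy; exact sub_le_sub_left hy b),
    ← intervalIntegral.integral_of_le (by linarith)]
  have key := intervalIntegral.integral_comp_sub_left
    (fun u => P.real {y | h y ≤ u}) (a := 0) (b := b - a) b
  simp only [sub_sub_cancel, sub_zero] at key
  rw [← key]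
  congr 1
  ext t
  congr 1
  ext y
  simp only [Set.mem_ofPred_eq]
  constructor <;> intro _ <;> linarith

theorem strictMonoOn_integral_sin_pow (m : ℕ) :
    StrictMonoOn (fun s : ℝ => ∫ t in (0 : ℝ)..s, Real.sin t ^ m) (Set.Icc 0 π) := by
  intro s hs t ht hst
  have hint : ∀ p q : ℝ, IntervalIntegrable (fun t => Real.sin t ^ m) volume p q :=
    fun p q => (by fun_prop : Continuous fun t => Real.sin t ^ m).intervalIntegrable p q
  have hpos : 0 < ∫ r in s..t, Real.sin r ^ m :=
    intervalIntegral.intervalIntegral_pos_of_pos_on (hint s t)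
      (fun r hr => pow_pos (Real.sin_pos_of_pos_of_lt_pi (hs.1.trans_lt hr.1)
        (hr.2.trans_le ht.2)) m) hst
  have := intervalIntegral.integral_add_adjacent_intervals (hint 0 s) (hint s t)
  simp only
  linarith

theorem le_iff_le_leftInverse {f g : ℝ → ℝ} {a b : ℝ} (hab : a ≤ b)
    (hfc : ContinuousOn f (Set.Icc a b)) (hfm : StrictMonoOn f (Set.Icc a b))
    (hgf : ∀ t ∈ Set.Icc a b, g (f t) = t) {u : ℝ} (hu : u ∈ Set.Icc (f a) (f b)) :
    g u ∈ Set.Icc a b ∧ ∀ r ∈ Set.Icc a b, f r ≤ u ↔ r ≤ g u := by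
  obtain ⟨t, ht, rfl⟩ := intermediate_value_Icc hab hfc hu
  rw [hgf t ht]
  exact ⟨ht, fun r hr => hfm.le_iff_le hr ht⟩

theorem integral_const_sub_mul_sin_pow {f g : ℝ → ℝ} (hfc : ContinuousOn f (Set.Icc 0 π))
    (hfm : StrictMonoOn f (Set.Icc 0 π)) (hgf : ∀ t ∈ Set.Icc (0 : ℝ) π, g (f t) = t) (m : ℕ) :
    ∫ r in (0 : ℝ)..π, (f π - f r) * Real.sin r ^ m
      = ∫ u in (f 0)..(f π), ∫ t in (0 : ℝ)..(g u), Real.sin t ^ m := by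
  have h0 : (0 : ℝ) ∈ Set.Icc 0 π := ⟨le_rfl, pi_pos.le⟩
  have hπ : π ∈ Set.Icc 0 π := ⟨pi_pos.le, le_rfl⟩
  have hsc : Continuous fun t => Real.sin t ^ m := by fun_prop
  set w : ℝ → ENNReal := fun t => ENNReal.ofReal (Real.sin t ^ m) with hw
  have hwm : Measurable w := by fun_prop
  set ν : Measure ℝ := volume.restrict (Set.Ioc 0 π) with hν
  have hsub : ∀ {s : ℝ}, s ∈ Set.Ioc 0 π → 0 ≤ Real.sin s ^ m := fun hs =>
    pow_nonneg (Real.sin_nonneg_of_nonneg_of_le_pi hs.1.le hs.2) m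
  have hfin : IsFiniteMeasure (ν.withDensity w) :=
    isFiniteMeasure_withDensity_ofReal
      ((hsc.integrableOn_Icc (a := 0) (b := π)).mono_set Set.Ioc_subset_Icc_self).2
  have hac : ν.withDensity w ≪ ν := withDensity_absolutelyContinuous _ _
  have hmem : ∀ᵐ r ∂(ν.withDensity w), r ∈ Set.Ioc 0 π :=
    hac.ae_le (ae_restrict_mem measurableSet_Ioc)
  have hfmeas : AEStronglyMeasurable f (ν.withDensity w) :=
    ((hfc.mono Set.Ioc_subset_Icc_self).aestronglyMeasurable measurableSet_Ioc).mono_ac hac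
  have key := (integral_const_sub_eq_intervalIntegral_sublevel (ν.withDensity w) hfmeas
    (hfm.monotoneOn h0 hπ pi_pos.le)
    (by filter_upwards [hmem] with r hr using hfm.monotoneOn h0 (Set.Ioc_subset_Icc_self hr) hr.1.le)
    (by filter_upwards [hmem] with r hr using hfm.monotoneOn (Set.Ioc_subset_Icc_self hr) hπ hr.2)).2
  have hl : ∫ r, (f π - f r) ∂(ν.withDensity w)
      = ∫ r in (0 : ℝ)..π, (f π - f r) * Real.sin r ^ m := by
    rw [integral_withDensity_eq_integral_toReal_smul hwm (by simp [hw]),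
      intervalIntegral.integral_of_le pi_pos.le]
    refine setIntegral_congr_fun measurableSet_Ioc fun r hr => ?_
    simp only [hw, ENNReal.toReal_ofReal (hsub hr), smul_eq_mul, mul_comm]
  rw [← hl, key]
  refine intervalIntegral.integral_congr fun u hu => ?_
  rw [Set.uIcc_of_le (hfm.monotoneOn h0 hπ pi_pos.le)] at hu
  obtain ⟨hgu, hiff⟩ := le_iff_le_leftInverse pi_pos.le hfc hfm hgf hu
  have hset : (ν.withDensity w) {r | f r ≤ u} = (ν.withDensity w) (Set.Ioc 0 (g u)) := by
    refine measure_congr ?_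
    filter_upwards [hmem] with r hr
    refine propext ((hiff r (Set.Ioc_subset_Icc_self hr)).trans ?_)
    exact ⟨fun h => ⟨hr.1, h⟩, fun h => h.2⟩
  have hcap : Set.Ioc 0 (g u) ∩ Set.Ioc 0 π = Set.Ioc 0 (g u) :=
    Set.inter_eq_left.2 (Set.Ioc_subset_Ioc_right hgu.2)
  simp only [Measure.real]
  rw [hset, withDensity_apply _ measurableSet_Ioc, hν, Measure.restrict_restrict measurableSet_Ioc,
    hcap, intervalIntegral.integral_of_le hgu.1, integral_eq_lintegral_of_nonneg_ae]
  · filter_upwards [ae_restrict_mem measurableSet_Ioc] with r hr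
    exact hsub ⟨hr.1, hr.2.trans hgu.2⟩
  · exact hsc.aestronglyMeasurable

/-- Quantitative pointwise `f`-mean-distance estimate: under the standing hypotheses,
for continuous strictly increasing `f : [0,π] → ℝ` with inverse `g` on `[f 0, f π]`
and `0 < ε < π`, if `x ∈ X` satisfies `D(x) = ⨆ y, d(x,y) ≤ π - ε`, then
`∫ y, f(d(x,y)) dμ(y) ≤ M*_{f,n} - δ₁(f,ε,n)` where
`M*_{f,n} = (∫₀^π f r (sin r)^{n-1} dr)/(∫₀^π (sin r)^{n-1} dr)` and
`δ₁(f,ε,n) = ∫_{f(π-ε)}^{f(π)} (1 - v n (g u)) du > 0`. -/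
theorem pointwise_f_mean_distance_gap {X : Type*} [MetricSpace X] [CompactSpace X]
    [MeasurableSpace X] [BorelSpace X]
    (μ : Measure X) [IsProbabilityMeasure μ] [μ.IsOpenPosMeasure]
    (n : ℕ) (hn : 2 ≤ n)
    (hdiam : Metric.diam (Set.univ : Set X) ≤ π)
    (hball : ∀ (x : X), ∀ s ∈ Set.Icc (0 : ℝ) π,
      (∫ t in (0 : ℝ)..s, Real.sin t ^ (n - 1))
          / (∫ t in (0 : ℝ)..π, Real.sin t ^ (n - 1))
        ≤ (μ (Metric.closedBall x s)).toReal)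
    (f : ℝ → ℝ) (hfc : ContinuousOn f (Set.Icc 0 π))
    (hfm : StrictMonoOn f (Set.Icc 0 π))
    (g : ℝ → ℝ) (hgf : ∀ t ∈ Set.Icc (0 : ℝ) π, g (f t) = t)
    (hfg : ∀ u ∈ Set.Icc (f 0) (f π), f (g u) = u)
    (ε : ℝ) (hε0 : 0 < ε) (hεπ : ε < π)
    (x : X) (hx : (⨆ y : X, dist x y) ≤ π - ε) :
    0 < (∫ u in (f (π - ε))..(f π),
          (1 - (∫ t in (0 : ℝ)..(g u), Real.sin t ^ (n - 1))
                / (∫ t in (0 : ℝ)..π, Real.sin t ^ (n - 1))))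
    ∧ ∫ y, f (dist x y) ∂μ
        ≤ (∫ r in (0 : ℝ)..π, f r * Real.sin r ^ (n - 1))
              / (∫ r in (0 : ℝ)..π, Real.sin r ^ (n - 1))
          - ∫ u in (f (π - ε))..(f π),
              (1 - (∫ t in (0 : ℝ)..(g u), Real.sin t ^ (n - 1))
                    / (∫ t in (0 : ℝ)..π, Real.sin t ^ (n - 1))) := by
  set m := n - 1
  set F : ℝ → ℝ := fun s => ∫ t in (0 : ℝ)..s, Real.sin t ^ m with hF
  change 0 < (∫ u in (f (π - ε))..(f π), (1 - F (g u) / F π)) ∧ _ ≤ _ / F π -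
    ∫ u in (f (π - ε))..(f π), (1 - F (g u) / F π)
  change ∀ (x : X), ∀ s ∈ Set.Icc (0 : ℝ) π, F s / F π ≤ μ.real (closedBall x s) at hball
  have hFm : StrictMonoOn F (Set.Icc 0 π) := strictMonoOn_integral_sin_pow m
  have h0 : (0 : ℝ) ∈ Set.Icc 0 π := ⟨le_rfl, pi_pos.le⟩
  have hπ : π ∈ Set.Icc 0 π := ⟨pi_pos.le, le_rfl⟩
  have hε : π - ε ∈ Set.Icc 0 π := ⟨by linarith, by linarith⟩
  have hFπ : 0 < F π := by simpa [hF] using hFm h0 hπ pi_pos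
  have hf0ε : f 0 ≤ f (π - ε) := hfm.monotoneOn h0 hε hε.1
  have hfεπ : f (π - ε) < f π := hfm hε hπ (by linarith)
  have hinv : ∀ u ∈ Set.Icc (f 0) (f π),
      g u ∈ Set.Icc 0 π ∧ ∀ r ∈ Set.Icc 0 π, f r ≤ u ↔ r ≤ g u :=
    fun u hu => le_iff_le_leftInverse pi_pos.le hfc hfm hgf hu
  have hvmono : MonotoneOn (fun u => F (g u) / F π) (Set.Icc (f 0) (f π)) := by
    intro u hu v hv huv
    have hguv : g u ≤ g v :=
      ((hinv v hv).2 _ (hinv u hu).1).1 (by rwa [hfg u hu])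
    exact div_le_div_of_nonneg_right
      (hFm.monotoneOn (hinv u hu).1 (hinv v hv).1 hguv) hFπ.le
  have hvint₁ : IntervalIntegrable (fun u => F (g u) / F π) volume (f 0) (f (π - ε)) :=
    MonotoneOn.intervalIntegrable (hvmono.mono (by
      rw [Set.uIcc_of_le hf0ε]; exact Set.Icc_subset_Icc_right hfεπ.le))
  have hvint₂ : IntervalIntegrable (fun u => F (g u) / F π) volume (f (π - ε)) (f π) :=
    MonotoneOn.intervalIntegrable (hvmono.mono (by
      rw [Set.uIcc_of_le hfεπ.le]; exact Set.Icc_subset_Icc_left hf0ε))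
  have hone : IntervalIntegrable (fun _ : ℝ => (1 : ℝ)) volume (f (π - ε)) (f π) :=
    intervalIntegrable_const
  constructor
  · refine intervalIntegral.intervalIntegral_pos_of_pos_on (hone.sub hvint₂) (fun u hu => ?_) hfεπ
    have hu' : u ∈ Set.Icc (f 0) (f π) := ⟨hf0ε.trans hu.1.le, hu.2.le⟩
    have hgu := (hinv u hu').1
    have hlt : g u < π := by
      refine lt_of_le_of_ne hgu.2 fun h => hu.2.ne ?_
      rw [← hfg u hu', h]
    rw [sub_pos, div_lt_one hFπ]
    exact hFm hgu hπ hlt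
  · have hd : ∀ y, dist x y ∈ Set.Icc 0 (π - ε) := fun y => by
      refine ⟨dist_nonneg, le_trans (le_ciSup (f := fun y => dist x y) ?_ y) hx⟩
      exact (isCompact_range (continuous_const.dist continuous_id)).bddAbove
    have hd' : ∀ y, dist x y ∈ Set.Icc 0 π := fun y => ⟨(hd y).1, (hd y).2.trans hε.2⟩
    have hcont : Continuous fun y => f (dist x y) :=
      hfc.comp_continuous (continuous_const.dist continuous_id) hd'
    obtain ⟨hi, hlayer⟩ := integral_const_sub_eq_intervalIntegral_sublevel μ
      hcont.aestronglyMeasurable hf0ε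
      (.of_forall fun y => hfm.monotoneOn h0 (hd' y) (hd y).1)
      (.of_forall fun y => hfm.monotoneOn (hd' y) hε (hd y).2)
    rw [integral_sub (integrable_const _) hi, integral_const, probReal_univ, one_smul] at hlayer
    have hle : ∫ u in (f 0)..(f (π - ε)), F (g u) / F π
        ≤ ∫ u in (f 0)..(f (π - ε)), μ.real {y | f (dist x y) ≤ u} := by
      refine intervalIntegral.integral_mono_on hf0ε hvint₁ ?_ fun u hu => ?_
      · refine Monotone.intervalIntegrable fun u v huv => measureReal_mono ?_
        exact fun y hy => le_trans hy huv
      · obtain ⟨hgu, hiff⟩ := hinv u ⟨hu.1, hu.2.trans hfεπ.le⟩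
        refine (hball x (g u) hgu).trans_eq ?_
        congr 1
        ext y
        rw [mem_closedBall, dist_comm]
        exact (hiff _ (hd' y)).symm
    have hmodel := integral_const_sub_mul_sin_pow hfc hfm hgf m
    have hsc : Continuous fun t => Real.sin t ^ m := by fun_prop
    have hfs : IntervalIntegrable (fun r => f r * Real.sin r ^ m) volume 0 π := by
      refine ContinuousOn.intervalIntegrable ?_
      rw [Set.uIcc_of_le pi_pos.le]
      exact hfc.mul hsc.continuousOn
    simp only [sub_mul] at hmodel
    rw [intervalIntegral.integral_sub ((hsc.intervalIntegrable 0 π).const_mul _) hfs,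
      intervalIntegral.integral_const_mul] at hmodel
    change f π * F π - _ = ∫ u in (f 0)..(f π), F (g u) at hmodel
    have hsplit := intervalIntegral.integral_add_adjacent_intervals hvint₁ hvint₂
    rw [intervalIntegral.integral_div (F π) (fun u => F (g u)) (a := f 0) (b := f π), ← hmodel,
      sub_div, mul_div_cancel_right₀ _ hFπ.ne'] at hsplit
    rw [intervalIntegral.integral_sub hone hvint₂, intervalIntegral.integral_const, smul_eq_mul,
      mul_one]
    linarith
end

section
/- Let (X,d) be a compact metric space and μ a Borel probability measure on X with full support. Let n ≥ 2 be an integer and set v_n(s) := (∫_0^s (sin t)^{n−1} dt)/(∫_0^π (sin t)^{n−1} dt) for s ∈ [0,π]. Assume diam(X,d) ≤ π and μ(B_s(x)) ≥ v_n(s) for every x ∈ X and every s ∈ [0,π], where B_s(x) is the closed ball of radius s around x. Let f : [0,π] → ℝ be continuous and strictly increasing, and let 0 < ε < π. If rad(X,d) := inf_{x∈X} sup_{y∈X} d(x,y) < π − ε, then M_f(X) := ∫_{X×X} f(d(x,y)) dμ(x)dμ(y) < M*_{f,n} − v_n(ε/2)·δ₁(f,ε/2,n), where M*_{f,n} :=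 (∫_0^π f(r)(sin r)^{n−1} dr)/(∫_0^π (sin r)^{n−1} dr) and δ₁(f,ε,n) := ∫_{f(π−ε)}^{f(π)} (1 − v_n(f^{−1}(u))) du. Consequently, if M_f(X) ≥ M*_{f,n} − v_n(ε/2)·δ₁(f,ε/2,n) then rad(X,d) ≥ π − ε. -/
open MeasureTheory Metric Real

/-- Layer-cake formula for a strictly increasing function `f` of a random variable `r` with values
in `[a, b]`, written in terms of the inverse `g` of `f`. -/
lemma integrable_and_integral_comp_eq_sub_integral_measureReal_le
    {Ω : Type*} [MeasurableSpace Ω] (ν : Measure Ω) [IsProbabilityMeasure ν]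
    {a b : ℝ} (hab : a ≤ b) {f g : ℝ → ℝ} (hfc : ContinuousOn f (Set.Icc a b))
    (hfm : StrictMonoOn f (Set.Icc a b)) (hgf : ∀ t ∈ Set.Icc a b, g (f t) = t)
    {r : Ω → ℝ} (hr : Measurable r) (hr_mem : ∀ᵐ ω ∂ν, r ω ∈ Set.Icc a b) :
    Integrable (fun ω => f (r ω)) ν ∧
      ∫ ω, f (r ω) ∂ν = f b - ∫ u in (f a)..(f b), ν.real {ω | r ω ≤ g u} := by
  have ha : a ∈ Set.Icc a b := Set.left_mem_Icc.2 hab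
  have hb : b ∈ Set.Icc a b := Set.right_mem_Icc.2 hab
  have hfab : f a ≤ f b := hfm.monotoneOn ha hb hab
  have hext : Continuous (Set.IccExtend hab ((Set.Icc a b).domRestrict f)) :=
    (continuousOn_iff_continuous_domRestrict.1 hfc).Icc_extend'
  have hae : (fun ω => Set.IccExtend hab ((Set.Icc a b).domRestrict f) (r ω))
      =ᵐ[ν] fun ω => f (r ω) := by
    filter_upwards [hr_mem] with ω hω
    rw [Set.IccExtend_of_mem _ _ hω]
    rfl
  have hmeas : AEStronglyMeasurable (fun ω => f (r ω)) ν :=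
    (hext.measurable.comp hr).aestronglyMeasurable.congr hae
  have hbound : ∀ᵐ ω ∂ν, f (r ω) ∈ Set.Icc (f a) (f b) := by
    filter_upwards [hr_mem] with ω hω
    exact ⟨hfm.monotoneOn ha hω hω.1, hfm.monotoneOn hω hb hω.2⟩
  have hint : Integrable (fun ω => f (r ω)) ν := Integrable.of_mem_Icc _ _ hmeas.aemeasurable hbound
  refine ⟨hint, ?_⟩
  have hcake := Integrable.integral_eq_integral_Ioc_meas_le (μ := ν)
    (f := fun ω => f b - f (r ω)) (M := f b - f a) ((integrable_const _).sub hint)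
    (by filter_upwards [hbound] with ω hω using sub_nonneg.2 hω.2)
    (by filter_upwards [hbound] with ω hω using sub_le_sub_left hω.1 _)
  rw [integral_sub (integrable_const _) hint, integral_const, probReal_univ, one_smul,
    ← intervalIntegral.integral_of_le (sub_nonneg.2 hfab)] at hcake
  have hsub := intervalIntegral.integral_comp_sub_left (a := 0) (b := f b - f a)
    (fun u => ν.real {ω | f (r ω) ≤ u}) (f b)
  rw [sub_zero, sub_sub_cancel] at hsub
  have hflip : ∀ t : ℝ, {ω | t ≤ f b - f (r ω)} = {ω | f (r ω) ≤ f b - t} := fun t => by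
    ext ω
    exact le_sub_comm (a := t) (b := f b) (c := f (r ω))
  simp only [hflip] at hcake
  rw [hsub] at hcake
  have hcongr : ∫ u in (f a)..(f b), ν.real {ω | f (r ω) ≤ u}
      = ∫ u in (f a)..(f b), ν.real {ω | r ω ≤ g u} := by
    refine intervalIntegral.integral_congr fun u hu => measureReal_congr ?_
    rw [Set.uIcc_of_le hfab] at hu
    obtain ⟨t, ht, rfl⟩ := intermediate_value_Icc hab hfc hu
    filter_upwards [hr_mem] with ω hω
    rw [hgf t ht]
    exact propext (hfm.le_iff_le hω ht)
  rw [hcongr] at hcake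
  linarith

/-- The monotone function `V`, composed with the inverse `g` of `f`, is monotone on
`[f a, f b]`. -/
lemma MonotoneOn.comp_inverse {a b : ℝ} (hab : a ≤ b) {f g V : ℝ → ℝ}
    (hfc : ContinuousOn f (Set.Icc a b)) (hfm : StrictMonoOn f (Set.Icc a b))
    (hgf : ∀ t ∈ Set.Icc a b, g (f t) = t) (hV : MonotoneOn V (Set.Icc a b)) :
    MonotoneOn (fun u => V (g u)) (Set.Icc (f a) (f b)) := by
  intro u hu w hw huw
  obtain ⟨s, hs, rfl⟩ := intermediate_value_Icc hab hfc hu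
  obtain ⟨t, ht, rfl⟩ := intermediate_value_Icc hab hfc hw
  simp only [hgf s hs, hgf t ht]
  exact hV hs ht ((hfm.le_iff_le hs ht).1 huw)

/-- If the distribution function of `r` dominates `V`, and `r ≤ ρ`, then the mean of `f ∘ r` is
controlled by the layer-cake integral of `V` with a gain coming from `[ρ, b]`. -/
lemma integral_comp_le_of_le_measureReal_le
    {Ω : Type*} [MeasurableSpace Ω] (ν : Measure Ω) [IsProbabilityMeasure ν]
    {a b : ℝ} {f g V : ℝ → ℝ} (hfc : ContinuousOn f (Set.Icc a b))
    (hfm : StrictMonoOn f (Set.Icc a b)) (hgf : ∀ t ∈ Set.Icc a b, g (f t) = t)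
    (hV : MonotoneOn V (Set.Icc a b))
    {r : Ω → ℝ} (hr : Measurable r) (hVr : ∀ s ∈ Set.Icc a b, V s ≤ ν.real {ω | r ω ≤ s})
    {ρ : ℝ} (hρ : ρ ∈ Set.Icc a b) (hr_mem : ∀ ω, r ω ∈ Set.Icc a ρ) :
    ∫ ω, f (r ω) ∂ν ≤ f b - (∫ u in (f a)..(f b), V (g u))
      - ∫ u in (f ρ)..(f b), (1 - V (g u)) := by
  have hab : a ≤ b := hρ.1.trans hρ.2
  have ha : a ∈ Set.Icc a b := Set.left_mem_Icc.2 hab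
  have hb : b ∈ Set.Icc a b := Set.right_mem_Icc.2 hab
  have hfaρ : f a ≤ f ρ := hfm.monotoneOn ha hρ hρ.1
  have hfρb : f ρ ≤ f b := hfm.monotoneOn hρ hb hρ.2
  have hfab := hfaρ.trans hfρb
  have hW : MonotoneOn (fun s => ν.real {ω | r ω ≤ s}) (Set.Icc a b) := fun s _ t _ hst =>
    measureReal_mono fun ω (hω : r ω ≤ s) => hω.trans hst
  have hsub : ∀ {x y : ℝ}, x ∈ Set.Icc (f a) (f b) → y ∈ Set.Icc (f a) (f b) →
      Set.uIcc x y ⊆ Set.Icc (f a) (f b) := fun hx hy => Set.uIcc_subset_Icc hx hy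
  have hVi : ∀ {x y : ℝ}, x ∈ Set.Icc (f a) (f b) → y ∈ Set.Icc (f a) (f b) →
      IntervalIntegrable (fun u => V (g u)) volume x y := fun hx hy =>
    ((hV.comp_inverse hab hfc hfm hgf).mono (hsub hx hy)).intervalIntegrable
  have hWi : ∀ {x y : ℝ}, x ∈ Set.Icc (f a) (f b) → y ∈ Set.Icc (f a) (f b) →
      IntervalIntegrable (fun u => ν.real {ω | r ω ≤ g u}) volume x y := fun hx hy =>
    ((hW.comp_inverse hab hfc hfm hgf).mono (hsub hx hy)).intervalIntegrable
  have hA : f a ∈ Set.Icc (f a) (f b) := ⟨le_rfl, hfab⟩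
  have hR : f ρ ∈ Set.Icc (f a) (f b) := ⟨hfaρ, hfρb⟩
  have hB : f b ∈ Set.Icc (f a) (f b) := ⟨hfab, le_rfl⟩
  rw [(integrable_and_integral_comp_eq_sub_integral_measureReal_le ν hab hfc hfm hgf hr
    (.of_forall fun ω => ⟨(hr_mem ω).1, (hr_mem ω).2.trans hρ.2⟩)).2,
    intervalIntegral.integral_sub intervalIntegrable_const (hVi hR hB),
    ← intervalIntegral.integral_add_adjacent_intervals (hVi hA hR) (hVi hR hB),
    ← intervalIntegral.integral_add_adjacent_intervals (hWi hA hR) (hWi hR hB)]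
  have hlow : ∫ u in (f a)..(f ρ), V (g u) ≤ ∫ u in (f a)..(f ρ), ν.real {ω | r ω ≤ g u} := by
    refine intervalIntegral.integral_mono_on hfaρ (hVi hA hR) (hWi hA hR) fun u hu => ?_
    obtain ⟨t, ht, rfl⟩ := intermediate_value_Icc hab hfc ⟨hu.1, hu.2.trans hfρb⟩
    rw [hgf t ht]
    exact hVr t ht
  have hhigh : ∫ u in (f ρ)..(f b), ν.real {ω | r ω ≤ g u} = ∫ _u in (f ρ)..(f b), (1 : ℝ) := by
    refine intervalIntegral.integral_congr fun u hu => ?_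
    rw [Set.uIcc_of_le hfρb] at hu
    obtain ⟨t, ht, rfl⟩ := intermediate_value_Icc hab hfc ⟨hfaρ.trans hu.1, hu.2⟩
    have hρt : ρ ≤ t := (hfm.le_iff_le hρ ht).1 hu.1
    have huniv : {ω | r ω ≤ t} = Set.univ :=
      Set.eq_univ_of_forall fun ω => (hr_mem ω).2.trans hρt
    simp only [hgf t ht, huniv, probReal_univ]
  linarith

/-- Layer-cake formula for the mean of `f` against the normalized density `sin ^ m` on `[0, π]`. -/
lemma integral_mul_sin_pow_div_eq_sub {m : ℕ} {f g : ℝ → ℝ} (hfc : ContinuousOn f (Set.Icc 0 π))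
    (hfm : StrictMonoOn f (Set.Icc 0 π)) (hgf : ∀ t ∈ Set.Icc (0 : ℝ) π, g (f t) = t) :
    (∫ r in (0 : ℝ)..π, f r * Real.sin r ^ m) / (∫ r in (0 : ℝ)..π, Real.sin r ^ m)
      = f π - ∫ u in (f 0)..(f π), (∫ t in (0 : ℝ)..(g u), Real.sin t ^ m)
          / (∫ t in (0 : ℝ)..π, Real.sin t ^ m) := by
  set c : ℝ := ∫ r in (0 : ℝ)..π, Real.sin r ^ m with hc
  have hcpos : 0 < c := integral_sin_pow_pos m
  let ν : Measure ℝ := (volume.restrict (Set.Ioc 0 π)).withDensity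
    fun t => ENNReal.ofReal (Real.sin t ^ m / c)
  have hdm : Measurable fun t : ℝ => ENNReal.ofReal (Real.sin t ^ m / c) := by fun_prop
  have hν : ∀ h : ℝ → ℝ, ∫ t, h t ∂ν = (∫ t in (0 : ℝ)..π, h t * Real.sin t ^ m) / c := by
    intro h
    rw [integral_withDensity_eq_integral_toReal_smul₀ hdm.aemeasurable
      (.of_forall fun _ => ENNReal.ofReal_lt_top), ← intervalIntegral.integral_div,
      intervalIntegral.integral_of_le pi_pos.le]
    refine setIntegral_congr_fun measurableSet_Ioc fun t ht => ?_
    have hs : 0 ≤ Real.sin t := sin_nonneg_of_nonneg_of_le_pi ht.1.le ht.2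
    simp only [ENNReal.toReal_ofReal (div_nonneg (pow_nonneg hs m) hcpos.le), smul_eq_mul]
    ring
  have huniv : ν.real Set.univ = 1 := by
    have h1 := hν fun _ => 1
    simp only [integral_const, smul_eq_mul, mul_one, one_mul] at h1
    rw [h1, ← hc, div_self hcpos.ne']
  have : IsProbabilityMeasure ν := ⟨by
    rw [measureReal_def] at huniv
    exact (ENNReal.toReal_eq_one_iff _).1 huniv⟩
  have hmem : ∀ᵐ t ∂ν, t ∈ Set.Icc (0 : ℝ) π :=
    (withDensity_absolutelyContinuous _ _).ae_le
      ((ae_restrict_mem measurableSet_Ioc).mono fun t ht => Set.Ioc_subset_Icc_self ht)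
  have hcdf : ∀ s ∈ Set.Icc (0 : ℝ) π,
      ν.real {t | t ≤ s} = (∫ t in (0 : ℝ)..s, Real.sin t ^ m) / c := by
    intro s hs
    have hset : MeasurableSet {t : ℝ | t ≤ s} := measurableSet_Iic
    rw [← integral_indicator_one hset, hν, ← intervalIntegral.integral_indicator hs]
    congr 2
    ext t
    by_cases hts : t ≤ s <;> simp [Set.indicator, hts]
  rw [← hν, (integrable_and_integral_comp_eq_sub_integral_measureReal_le ν pi_pos.le hfc hfm hgf
    (r := fun t => t) measurable_id hmem).2]
  congr 1
  refine intervalIntegral.integral_congr fun u hu => ?_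
  rw [Set.uIcc_of_le (hfm.monotoneOn (Set.left_mem_Icc.2 pi_pos.le)
    (Set.right_mem_Icc.2 pi_pos.le) pi_pos.le)] at hu
  obtain ⟨t, ht, rfl⟩ := intermediate_value_Icc pi_pos.le hfc hu
  simp only [hgf t ht]
  exact hcdf t ht

/-- The normalized primitive of `sin ^ m` is strictly increasing on `[0, π]`. -/
lemma strictMonoOn_integral_sin_pow_div (m : ℕ) :
    StrictMonoOn (fun s : ℝ => (∫ t in (0 : ℝ)..s, Real.sin t ^ m)
      / (∫ t in (0 : ℝ)..π, Real.sin t ^ m)) (Set.Icc 0 π) := by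
  intro s hs t ht hst
  have hi : ∀ x y : ℝ, IntervalIntegrable (fun t => Real.sin t ^ m) volume x y := fun x y =>
    (by fun_prop : Continuous fun t : ℝ => Real.sin t ^ m).intervalIntegrable x y
  have hpos : 0 < ∫ t in s..t, Real.sin t ^ m :=
    intervalIntegral.intervalIntegral_pos_of_pos_on (hi s t) (fun x hx =>
      pow_pos (sin_pos_of_pos_of_lt_pi (hs.1.trans_lt hx.1) (hx.2.trans_le ht.2)) m) hst
  have hadd := intervalIntegral.integral_add_adjacent_intervals (hi 0 s) (hi s t)
  exact div_lt_div_of_pos_right (by linarith) (integral_sin_pow_pos m)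

/-- If all points of a ball of positive volume see the whole space within distance `ρ < σ < b`,
then the mean of `f ∘ dist` drops strictly below the model value by the volume bound times the
gain on `[σ, b]`. -/
lemma integral_prod_comp_dist_lt {X : Type*} [MetricSpace X] [CompactSpace X]
    [MeasurableSpace X] [BorelSpace X] (μ : Measure X) [IsProbabilityMeasure μ]
    {b : ℝ} (hdist : ∀ x y : X, dist x y ≤ b)
    {f g V : ℝ → ℝ} (hfc : ContinuousOn f (Set.Icc 0 b)) (hfm : StrictMonoOn f (Set.Icc 0 b))
    (hgf : ∀ t ∈ Set.Icc 0 b, g (f t) = t) (hV : StrictMonoOn V (Set.Icc 0 b)) (hVb : V b = 1)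
    (hball : ∀ x : X, ∀ s ∈ Set.Icc 0 b, V s ≤ μ.real (closedBall x s))
    {x₀ : X} {R v ρ σ : ℝ} (hv : 0 < v) (hvR : v ≤ μ.real (closedBall x₀ R))
    (hfar : ∀ x ∈ closedBall x₀ R, ∀ y, dist x y ≤ ρ) (hρ : 0 ≤ ρ) (hρσ : ρ < σ) (hσ : σ ≤ b) :
    ∫ p : X × X, f (dist p.1 p.2) ∂(μ.prod μ)
      < f b - (∫ u in (f 0)..(f b), V (g u)) - v * ∫ u in (f σ)..(f b), (1 - V (g u)) := by
  have hρb : ρ ≤ b := hρσ.le.trans hσ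
  have hb : 0 ≤ b := hρ.trans hρb
  have hb_mem : b ∈ Set.Icc 0 b := ⟨hb, le_rfl⟩
  have hρ_mem : ρ ∈ Set.Icc 0 b := ⟨hρ, hρb⟩
  have hσ_mem : σ ∈ Set.Icc 0 b := ⟨hρ.trans hρσ.le, hσ⟩
  have h0_mem : (0 : ℝ) ∈ Set.Icc 0 b := ⟨le_rfl, hb⟩
  have hint : Integrable (fun p : X × X => f (dist p.1 p.2)) (μ.prod μ) :=
    (integrable_and_integral_comp_eq_sub_integral_measureReal_le (μ.prod μ) hb hfc hfm hgf
      (continuous_fst.dist continuous_snd).measurable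
      (.of_forall fun p => ⟨dist_nonneg, hdist p.1 p.2⟩)).1
  set A : ℝ := f b - ∫ u in (f 0)..(f b), V (g u)
  set δ : ℝ := ∫ u in (f ρ)..(f b), (1 - V (g u)) with hδ
  have hcdf : ∀ x : X, ∀ s ∈ Set.Icc 0 b, V s ≤ μ.real {y | dist x y ≤ s} := fun x s hs => by
    simpa only [closedBall, dist_comm] using hball x s hs
  have hmeas : ∀ x : X, Measurable (dist x) := fun x =>
    (continuous_const.dist continuous_id).measurable
  have hpt : ∀ x, ∫ y, f (dist x y) ∂μ ≤ A - (closedBall x₀ R).indicator (fun _ => δ) x := by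
    intro x
    by_cases hx : x ∈ closedBall x₀ R
    · rw [Set.indicator_of_mem hx]
      exact integral_comp_le_of_le_measureReal_le μ hfc hfm hgf hV.monotoneOn (hmeas x) (hcdf x)
        hρ_mem fun y => ⟨dist_nonneg, hfar x hx y⟩
    · rw [Set.indicator_of_notMem hx]
      simpa using integral_comp_le_of_le_measureReal_le μ hfc hfm hgf hV.monotoneOn (hmeas x)
        (hcdf x) hb_mem fun y => ⟨dist_nonneg, hdist x y⟩
  have hmean : ∫ p : X × X, f (dist p.1 p.2) ∂(μ.prod μ) ≤ A - μ.real (closedBall x₀ R) * δ := by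
    have hind : Integrable ((closedBall x₀ R).indicator fun _ => δ) μ :=
      (integrable_const δ).indicator measurableSet_closedBall
    rw [integral_prod _ hint]
    refine (integral_mono hint.integral_prod_left ((integrable_const A).sub hind) hpt).trans_eq ?_
    simp only [Pi.sub_apply]
    rw [integral_sub (integrable_const A) hind,
      integral_indicator_const _ measurableSet_closedBall]
    simp
  have hanti : AntitoneOn (fun u => 1 - V (g u)) (Set.Icc (f 0) (f b)) := fun u hu w hw huw =>
    sub_le_sub_left (hV.monotoneOn.comp_inverse hb hfc hfm hgf hu hw huw) 1
  have hmono := hfm.monotoneOn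
  have hi : ∀ s ∈ Set.Icc 0 b, ∀ t ∈ Set.Icc 0 b,
      IntervalIntegrable (fun u => 1 - V (g u)) volume (f s) (f t) := fun s hs t ht =>
    (hanti.mono (Set.uIcc_subset_Icc ⟨hmono h0_mem hs hs.1, hmono hs hb_mem hs.2⟩
      ⟨hmono h0_mem ht ht.1, hmono ht hb_mem ht.2⟩)).intervalIntegrable
  have hfσb := hmono hσ_mem hb_mem hσ
  have hgain_nonneg : 0 ≤ ∫ u in (f σ)..(f b), (1 - V (g u)) := by
    refine intervalIntegral.integral_nonneg hfσb fun u hu => ?_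
    obtain ⟨t, ht, rfl⟩ := intermediate_value_Icc hb hfc
      ⟨(hmono h0_mem hσ_mem hσ_mem.1).trans hu.1, hu.2⟩
    rw [hgf t ht, sub_nonneg, ← hVb]
    exact hV.monotoneOn ht hb_mem ht.2
  have hgain_pos : 0 < ∫ u in (f ρ)..(f σ), (1 - V (g u)) := by
    refine intervalIntegral.intervalIntegral_pos_of_pos_on (hi ρ hρ_mem σ hσ_mem)
      (fun u hu => ?_) (hfm hρ_mem hσ_mem hρσ)
    have hub := hu.2.trans_le hfσb
    obtain ⟨t, ht, rfl⟩ := intermediate_value_Icc hb hfc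
      ⟨(hmono h0_mem hρ_mem hρ).trans hu.1.le, hub.le⟩
    rw [hgf t ht, sub_pos, ← hVb]
    exact hV ht hb_mem ((hfm.lt_iff_lt ht hb_mem).1 hub)
  have hsplit := intervalIntegral.integral_add_adjacent_intervals (hi ρ hρ_mem σ hσ_mem)
    (hi σ hσ_mem b hb_mem)
  rw [← hδ] at hsplit
  have h1 : v * δ ≤ μ.real (closedBall x₀ R) * δ :=
    mul_le_mul_of_nonneg_right hvR (by linarith)
  have h2 : v * (∫ u in (f σ)..(f b), (1 - V (g u))) < v * δ :=
    mul_lt_mul_of_pos_left (by linarith) hv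
  linarith

/-- Quantitative `f`-mean-distance / radius estimate (core of the paper's Corollary):
under the standing hypotheses, for continuous strictly increasing `f : [0,π] → ℝ`
with inverse `g` on `[f 0, f π]` and `0 < ε < π`, if
`rad(X,d) = ⨅ x, ⨆ y, d(x,y) < π - ε`, then
`M_f(X) = ∫_{X×X} f(d) dμ⊗dμ < M*_{f,n} - v n (ε/2) · δ₁(f,ε/2,n)`, where
`M*_{f,n} = (∫₀^π f r (sin r)^{n-1} dr)/(∫₀^π (sin r)^{n-1} dr)` and
`δ₁(f,ε,n) = ∫_{f(π-ε)}^{f(π)} (1 - v n (g u)) du`; consequently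
`M_f(X) ≥ M*_{f,n} - v n (ε/2) · δ₁(f,ε/2,n)` implies `rad(X,d) ≥ π - ε`. -/
theorem f_mean_distance_radius_estimate {X : Type*} [MetricSpace X] [CompactSpace X]
    [MeasurableSpace X] [BorelSpace X]
    (μ : Measure X) [IsProbabilityMeasure μ] [μ.IsOpenPosMeasure]
    (n : ℕ) (hn : 2 ≤ n)
    (hdiam : Metric.diam (Set.univ : Set X) ≤ π)
    (hball : ∀ (x : X), ∀ s ∈ Set.Icc (0 : ℝ) π,
      (∫ t in (0 : ℝ)..s, Real.sin t ^ (n - 1))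
          / (∫ t in (0 : ℝ)..π, Real.sin t ^ (n - 1))
        ≤ (μ (Metric.closedBall x s)).toReal)
    (f : ℝ → ℝ) (hfc : ContinuousOn f (Set.Icc 0 π))
    (hfm : StrictMonoOn f (Set.Icc 0 π))
    (g : ℝ → ℝ) (hgf : ∀ t ∈ Set.Icc (0 : ℝ) π, g (f t) = t)
    (hfg : ∀ u ∈ Set.Icc (f 0) (f π), f (g u) = u)
    (ε : ℝ) (hε0 : 0 < ε) (hεπ : ε < π) :
    ((⨅ x : X, ⨆ y : X, dist x y) < π - ε →
      ∫ p : X × X, f (dist p.1 p.2) ∂(μ.prod μ)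
        < (∫ r in (0 : ℝ)..π, f r * Real.sin r ^ (n - 1))
              / (∫ r in (0 : ℝ)..π, Real.sin r ^ (n - 1))
          - ((∫ t in (0 : ℝ)..(ε / 2), Real.sin t ^ (n - 1))
                / (∫ t in (0 : ℝ)..π, Real.sin t ^ (n - 1)))
            * ∫ u in (f (π - ε / 2))..(f π),
                (1 - (∫ t in (0 : ℝ)..(g u), Real.sin t ^ (n - 1))
                      / (∫ t in (0 : ℝ)..π, Real.sin t ^ (n - 1))))
    ∧ ((∫ r in (0 : ℝ)..π, f r * Real.sin r ^ (n - 1))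
              / (∫ r in (0 : ℝ)..π, Real.sin r ^ (n - 1))
          - ((∫ t in (0 : ℝ)..(ε / 2), Real.sin t ^ (n - 1))
                / (∫ t in (0 : ℝ)..π, Real.sin t ^ (n - 1)))
            * (∫ u in (f (π - ε / 2))..(f π),
                (1 - (∫ t in (0 : ℝ)..(g u), Real.sin t ^ (n - 1))
                      / (∫ t in (0 : ℝ)..π, Real.sin t ^ (n - 1))))
        ≤ ∫ p : X × X, f (dist p.1 p.2) ∂(μ.prod μ) →
      π - ε ≤ ⨅ x : X, ⨆ y : X, dist x y) := by
  have := nonempty_of_isProbabilityMeasure μ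
  have hVm := strictMonoOn_integral_sin_pow_div (n - 1)
  have hdist : ∀ x y : X, dist x y ≤ π := fun x y =>
    (dist_le_diam_of_mem isCompact_univ.isBounded (Set.mem_univ x) (Set.mem_univ y)).trans hdiam
  rw [integral_mul_sin_pow_div_eq_sub hfc hfm hgf]
  refine (and_iff_left_of_imp fun h hle => ?_).2 fun hrad => ?_
  · by_contra! hlt
    exact (h hlt).not_ge hle
  · obtain ⟨x₀, hx₀⟩ := exists_lt_of_ciInf_lt hrad
    have hbdd : BddAbove (Set.range fun y => dist x₀ y) :=
      ⟨π, Set.forall_mem_range.2 (hdist x₀)⟩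
    have hle : ∀ y, dist x₀ y ≤ ⨆ y, dist x₀ y := fun y => le_ciSup hbdd y
    have hsup : 0 ≤ ⨆ y, dist x₀ y := dist_nonneg.trans (hle x₀)
    have hε_mem : ε / 2 ∈ Set.Icc (0 : ℝ) π := ⟨by linarith, by linarith⟩
    refine integral_prod_comp_dist_lt μ hdist hfc hfm hgf hVm (div_self (integral_sin_pow_pos _).ne')
      hball ?_ (hball x₀ (ε / 2) hε_mem) (ρ := (⨆ y, dist x₀ y) + ε / 2) (fun x hx y => ?_)
      (by linarith) (by linarith) (by linarith)
    · simpa using hVm (Set.left_mem_Icc.2 pi_pos.le) hε_mem (half_pos hε0)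
    · have := dist_triangle x x₀ y
      have := hle y
      have := mem_closedBall.1 hx
      linarith
end
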